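/- arXiv:1606.08349 — 2 statements merged into one kernel-verified Lean document; each statement's English description precedes it below -/
import Mathlib

section
/- Let A and B be Banach algebras such that A has an identity and B has a non-zero idempotent element. If the projective tensor product A⊗_p B is approximately biflat, then A is approximately biflat, and consequently A is pseudo-amenable. -/
set_option synthInstance.maxHeartbeats 1000000
set_option maxHeartbeats 4000000
set_option maxSynthPendingDepth 3
set_option linter.unusedSectionVars false
set_option linter.unusedVariables false
open scoped Topology
open Filter ContinuousLinearMap

noncomputable section

namespace ApproxBiflat

variable (A : Type*) [NonUnitalNormedRing A] [NormedSpace ℂ A]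
  [IsScalarTower ℂ A A] [SMulCommClass ℂ A A]

/-- The dual space `A*` of a Banach algebra `A`. -/
abbrev Dual' := A →L[ℂ] ℂ

/-- Bounded bilinear forms on `A × A`; this is the canonical isometric model of the dual
`(A ⊗_p A)*` of the projective tensor product `A ⊗_p A`. -/
abbrev BilForm := A →L[ℂ] A →L[ℂ] ℂ

/-- The canonical model of the second dual `(A ⊗_p A)**` of the projective tensor product. -/
abbrev TensorBidual := (A →L[ℂ] A →L[ℂ] ℂ) →L[ℂ] ℂ

/-- The bidual of a Banach algebra, as a Banach space. -/
abbrev Bidual := (A →L[ℂ] ℂ) →L[ℂ] ℂ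

variable {A}

/-- The left action of `A` on `A* = (A →L ℂ)`: `(a · f) x = f (x * a)`. -/
def dualLeft (a : A) : Dual' A →L[ℂ] Dual' A :=
  (compL ℂ A A ℂ).flip ((ContinuousLinearMap.mul ℂ A).flip a)

/-- The right action of `A` on `A*`: `(f · a) x = f (a * x)`. -/
def dualRight (a : A) : Dual' A →L[ℂ] Dual' A :=
  (compL ℂ A A ℂ).flip (ContinuousLinearMap.mul ℂ A a)

@[simp] lemma dualLeft_apply (a : A) (f : Dual' A) (x : A) : dualLeft a f x = f (x * a) := rfl
@[simp] lemma dualRight_apply (a : A) (f : Dual' A) (x : A) : dualRight a f x = f (a * x) := rfl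

/-- The adjoint `π* : A* → (A ⊗_p A)*` of the multiplication map
`π : A ⊗_p A → A`, in the bilinear-form model: `(π* f) a b = f (a * b)`. -/
def piStar : Dual' A →L[ℂ] BilForm A :=
  ((compL ℂ A (A →L[ℂ] A) (A →L[ℂ] ℂ)).flip (ContinuousLinearMap.mul ℂ A)).comp
    (compL ℂ A A ℂ)

@[simp] lemma piStar_apply (f : Dual' A) (a b : A) : piStar f a b = f (a * b) := rfl

/-- The left action of `A` on `(A ⊗_p A)*`: `(a · T) b c = T b (c * a)`. -/
def bilLeft (a : A) : BilForm A →L[ℂ] BilForm A :=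
  compL ℂ A (A →L[ℂ] ℂ) (A →L[ℂ] ℂ) (dualLeft a)

/-- The right action of `A` on `(A ⊗_p A)*`: `(T · a) b c = T (a * b) c`. -/
def bilRight (a : A) : BilForm A →L[ℂ] BilForm A :=
  (compL ℂ A A (A →L[ℂ] ℂ)).flip (ContinuousLinearMap.mul ℂ A a)

@[simp] lemma bilLeft_apply (a : A) (T : BilForm A) (b c : A) :
    bilLeft a T b c = T b (c * a) := rfl
@[simp] lemma bilRight_apply (a : A) (T : BilForm A) (b c : A) :
    bilRight a T b c = T (a * b) c := rfl

/-- The left action of `A` on `(A ⊗_p A)**`: `a · m = m ∘ (T ↦ T · a)`. -/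
def tbLeft (a : A) (m : TensorBidual A) : TensorBidual A := m.comp (bilRight a)

/-- The right action of `A` on `(A ⊗_p A)**`: `m · a = m ∘ (T ↦ a · T)`. -/
def tbRight (m : TensorBidual A) (a : A) : TensorBidual A := m.comp (bilLeft a)

/-- The elementary tensor `a ⊗ b`, viewed canonically inside `(A ⊗_p A)**`. -/
def dyad (a b : A) : TensorBidual A :=
  (ContinuousLinearMap.apply ℂ ℂ b).comp (ContinuousLinearMap.apply ℂ (A →L[ℂ] ℂ) a)

@[simp] lemma dyad_apply (a b : A) (T : BilForm A) : dyad a b T = T a b := rfl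

variable (A) in
/-- The canonical isometric image of the projective tensor product `A ⊗_p A` inside its bidual
`(A ⊗_p A)**`: the closure of the linear span of the elementary tensors. -/
def tensorSpan : Submodule ℂ (TensorBidual A) :=
  (Submodule.span ℂ {m : TensorBidual A | ∃ a b : A, m = dyad a b}).topologicalClosure

/-- The double adjoint `π** : (A ⊗_p A)** → A**` of the multiplication map. -/
def piStarStar (m : TensorBidual A) : Bidual A := m.comp piStar

/-- `ρ : (A ⊗_p A)* → A*` is a morphism of Banach `A`-bimodules. -/
def IsBimodMorphism (ρ : BilForm A →L[ℂ] Dual' A) : Prop :=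
  ∀ (a : A) (T : BilForm A),
    ρ (bilLeft a T) = dualLeft a (ρ T) ∧ ρ (bilRight a T) = dualRight a (ρ T)

variable (A)

/-- A Banach algebra `A` is **biflat** if there is a bounded `A`-bimodule morphism
`ρ : (A ⊗_p A)* → A*` with `ρ ∘ π* = id`. -/
def Biflat : Prop :=
  ∃ ρ : BilForm A →L[ℂ] Dual' A, IsBimodMorphism ρ ∧ ∀ f : Dual' A, ρ (piStar f) = f

/-- A Banach algebra `A` is **approximately biflat** if there is a net `(ρ_α)` of bounded
`A`-bimodule morphisms `(A ⊗_p A)* → A*` with `ρ_α ∘ π* → id_{A*}` in the weak-star operator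
topology.  (Nets are encoded by filters in the standard way.) -/
def ApproximatelyBiflat : Prop :=
  ∃ l : Filter (BilForm A →L[ℂ] Dual' A), l.NeBot ∧
    (∀ᶠ ρ in l, IsBimodMorphism ρ) ∧
    ∀ (f : Dual' A) (a : A), Tendsto (fun ρ => ρ (piStar f) a) l (𝓝 (f a))

/-- A Banach algebra `A` is **pseudo-amenable** if there is a net `(m_α)` in `A ⊗_p A`
(realized isometrically inside `(A ⊗_p A)**` as `tensorSpan A`) such that
`a · m_α - m_α · a → 0` and `π(m_α) a → a` for every `a ∈ A`. -/
def PseudoAmenable : Prop :=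
  ∃ l : Filter (TensorBidual A), l.NeBot ∧
    (∀ᶠ m in l, m ∈ tensorSpan A) ∧
    (∀ a : A, Tendsto (fun m => tbLeft a m - tbRight m a) l (𝓝 0)) ∧
    ∀ a : A, Tendsto (fun m => (piStarStar m).comp (dualLeft a)) l
      (𝓝 (NormedSpace.inclusionInDoubleDual ℂ A a))

/-- `A` has a (two-sided, not necessarily bounded) approximate identity. -/
def HasApproximateIdentity : Prop :=
  ∃ l : Filter A, l.NeBot ∧
    ∀ a : A, Tendsto (fun e => a * e) l (𝓝 a) ∧ Tendsto (fun e => e * a) l (𝓝 a)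

end ApproxBiflat
namespace ApproxBiflat

universe u v

/-- `C`, together with the bounded bilinear map `tp : A × B → C`, *is* the projective tensor
product `A ⊗_p B` of the Banach spaces `A` and `B`: `tp` is contractive and `(C, tp)` has the
universal property (with uniqueness and norm control) for bounded bilinear maps into Banach
spaces.  This characterizes `A ⊗_p B` up to isometric isomorphism. -/
structure IsProjectiveTensorProduct {A B C : Type u}
    [NormedAddCommGroup A] [NormedSpace ℂ A]
    [NormedAddCommGroup B] [NormedSpace ℂ B]
    [NormedAddCommGroup C] [NormedSpace ℂ C] [CompleteSpace C]
    (tp : A →L[ℂ] B →L[ℂ] C) : Prop where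
  norm_tp_le : ∀ (a : A) (b : B), ‖tp a b‖ ≤ ‖a‖ * ‖b‖
  lift : ∀ (Y : Type u) [NormedAddCommGroup Y] [NormedSpace ℂ Y] [CompleteSpace Y]
    (β : A →L[ℂ] B →L[ℂ] Y),
    ∃! h : C →L[ℂ] Y, (∀ (a : A) (b : B), h (tp a b) = β a b) ∧ ‖h‖ ≤ ‖β‖

end ApproxBiflat
namespace ApproxBiflat

section Closure

variable {V W ι : Type*} [AddCommGroup V] [Module ℂ V] [NormedAddCommGroup W] [NormedSpace ℂ W]

/-- A point annihilated by every continuous functional vanishing on a subspace lies in the closure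
of this subspace. -/
lemma mem_closure_of_forall_dual (p : Submodule ℂ W) (x : W)
    (h : ∀ φ : W →L[ℂ] ℂ, (∀ y ∈ p, φ y = 0) → φ x = 0) : x ∈ closure (p : Set W) := by
  by_contra hx
  let q := p.topologicalClosure
  have : IsClosed (q : Set W) := p.isClosed_topologicalClosure
  have hne : q.mkQL x ≠ 0 := by
    intro h0
    exact hx ((Submodule.Quotient.mk_eq_zero q).1 h0)
  obtain ⟨ψ, hψ⟩ := SeparatingDual.exists_eq_one (R := ℂ) hne
  have := h (ψ.comp q.mkQL) fun y hy => by
    have : q.mkQL y = 0 :=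
      (Submodule.Quotient.mk_eq_zero q).2 (p.le_topologicalClosure hy)
    simp only [ContinuousLinearMap.comp_apply, this, map_zero]
  rw [ContinuousLinearMap.comp_apply, hψ] at this
  exact one_ne_zero this

/-- A system of linear equations `D i v = w i` is approximately solvable in a subspace as soon as
every finite family of functionals annihilating the left-hand sides annihilates the right-hand
sides. -/
lemma exists_filter_tendsto_of_forall_dual (p : Submodule ℂ V) (D : ι → V →ₗ[ℂ] W) (w : ι → W)
    (h : ∀ (I : Finset ι) (φ : I → W →L[ℂ] ℂ),
      (∀ v ∈ p, ∑ i : I, φ i (D i v) = 0) → ∑ i : I, φ i (w i) = 0) :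
    ∃ l : Filter V, l.NeBot ∧ (∀ᶠ v in l, v ∈ p) ∧ ∀ i, Tendsto (D i) l (𝓝 (w i)) := by
  classical
  have key : w ∈ closure ((fun v i => D i v) '' (p : Set V)) := by
    rw [mem_closure_iff]
    intro o ho hw
    obtain ⟨I, u, hu, hsub⟩ := isOpen_pi_iff.1 ho w hw
    let DI : V →ₗ[ℂ] (I → W) := LinearMap.pi fun i => D i
    have hcl : (fun i : I => w i) ∈ closure ((p.map DI : Submodule ℂ (I → W)) : Set (I → W)) := by
      refine mem_closure_of_forall_dual _ _ fun φ hφ => ?_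
      have hsum : ∀ x : I → W,
          φ x = ∑ i : I, (φ.comp (ContinuousLinearMap.single ℂ (fun _ : I => W) i)) (x i) := by
        intro x
        conv_lhs => rw [← Finset.univ_sum_single x]
        simp
      rw [hsum]
      refine h I _ fun v hv => ?_
      rw [← hφ (DI v) (Submodule.mem_map_of_mem hv), hsum (DI v)]
      rfl
    have hopen : IsOpen (Set.pi Set.univ fun i : I => u i) :=
      isOpen_set_pi Set.finite_univ fun i _ => (hu i i.2).1
    obtain ⟨y, hy, v, hv, rfl⟩ := mem_closure_iff.1 hcl _ hopen fun i _ => (hu i i.2).2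
    exact ⟨fun i => D i v, hsub fun i hi => hy ⟨i, hi⟩ trivial, v, hv, rfl⟩
  refine ⟨comap (fun v i => D i v) (𝓝 w) ⊓ 𝓟 (p : Set V), ?_, ?_, fun i => ?_⟩
  · rw [mem_closure_iff_nhds] at key
    rw [inf_principal_neBot_iff]
    rintro U ⟨t, ht, htU⟩
    obtain ⟨_, hyt, v, hv, rfl⟩ := key t ht
    exact ⟨v, htU hyt, hv⟩
  · exact mem_inf_of_right (mem_principal_self _)
  · have hpi : Tendsto (fun v i => D i v) (comap (fun v i => D i v) (𝓝 w)) (𝓝 w) := tendsto_comap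
    exact (tendsto_pi_nhds.1 hpi i).mono_left inf_le_left

end Closure

section PseudoAmenable

variable {A : Type*} [NonUnitalNormedRing A] [NormedSpace ℂ A]
  [IsScalarTower ℂ A A] [SMulCommClass ℂ A A]

/-- The bounded bilinear map `(a, b) ↦ a ⊗ b`. -/
def dyadL : A →L[ℂ] A →L[ℂ] TensorBidual A :=
  (flipₗᵢ ℂ (BilForm A) A ℂ : (BilForm A →L[ℂ] A →L[ℂ] ℂ) →L[ℂ] A →L[ℂ] BilForm A →L[ℂ] ℂ).comp
    (ContinuousLinearMap.id ℂ (BilForm A)).flip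

/-- The linear map `m ↦ (a · m - m · a, π(m) a)`. -/
def diagonalDefect (a : A) : TensorBidual A →ₗ[ℂ] TensorBidual A × Bidual A where
  toFun m := (tbLeft a m - tbRight m a, (piStarStar m).comp (dualLeft a))
  map_add' m n := by
    ext T
    · simp only [tbLeft, tbRight, ContinuousLinearMap.comp_apply, _root_.add_apply,
        _root_.sub_apply, Prod.fst_add]
      ring
    · rfl
  map_smul' c m := by
    ext T
    · simp only [tbLeft, tbRight, ContinuousLinearMap.comp_apply, _root_.smul_apply,
        _root_.sub_apply, Prod.smul_fst, smul_sub, RingHom.id_apply]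
    · rfl

/-- A unital approximately biflat Banach algebra is pseudo-amenable. -/
lemma ApproximatelyBiflat.pseudoAmenable (e : A) (he : ∀ a : A, e * a = a ∧ a * e = a)
    (hA : ApproximatelyBiflat A) : PseudoAmenable A := by
  obtain ⟨L, hL, hbim, hlim⟩ := hA
  obtain ⟨l, hl, hmem, hten⟩ := exists_filter_tendsto_of_forall_dual
    (Submodule.span ℂ {m : TensorBidual A | ∃ a b : A, m = dyad a b}) diagonalDefect
    (fun a => ((0 : TensorBidual A), NormedSpace.inclusionInDoubleDual ℂ A a)) <| by
      intro I φ hφ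
      let T : I → BilForm A := fun i =>
        (compL ℂ A (TensorBidual A) ℂ
          ((φ i).comp (ContinuousLinearMap.inl ℂ (TensorBidual A) (Bidual A)))).comp dyadL
      let g : I → Dual' A := fun i =>
        ((φ i).comp (ContinuousLinearMap.inr ℂ (TensorBidual A) (Bidual A))).comp
          (NormedSpace.inclusionInDoubleDual ℂ A)
      have hsplit : ∀ (i : I) (m : TensorBidual A) (n : Bidual A),
          φ i (m, n) = φ i (m, 0) + φ i (0, n) := by
        intro i m n
        rw [← map_add]
        simp
      have hzero : (∑ i : I, (bilRight (i : A) (T i) - bilLeft (i : A) (T i)))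
          + piStar (∑ i : I, dualLeft (i : A) (g i)) = 0 := by
        ext x y
        have := hφ (dyad x y) (Submodule.subset_span ⟨x, y, rfl⟩)
        rw [← Finset.sum_congr rfl fun i _ => (hsplit i _ _).symm, Finset.sum_add_distrib] at this
        simp only [_root_.add_apply, _root_.sum_apply, piStar_apply,
          _root_.sub_apply, bilLeft_apply, bilRight_apply, dualLeft_apply,
          _root_.zero_apply]
        rw [← this]
        congr 1
        refine Finset.sum_congr rfl fun i _ => ?_
        change φ i (dyad (i * x) y, 0) - φ i (dyad x (y * i), 0) =
          φ i (dyad (i * x) y - dyad x (y * i), 0)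
        rw [← map_sub]
        simp
      have hρ : ∀ᶠ ρ in L, ρ (piStar (∑ i : I, dualLeft (i : A) (g i))) e = 0 := by
        filter_upwards [hbim] with ρ hρ
        have h1 := congrArg (fun S => ρ S e) hzero
        simp only [map_add, map_sum, map_sub, (hρ _ _).1, (hρ _ _).2, map_zero,
          _root_.add_apply, _root_.sum_apply,
          _root_.sub_apply, dualLeft_apply, dualRight_apply, (he _).1, (he _).2,
          sub_self, Finset.sum_const_zero, zero_add, _root_.zero_apply] at h1
        simpa only [map_sum, _root_.sum_apply] using h1
      have hval := tendsto_nhds_unique (hlim (∑ i : I, dualLeft (i : A) (g i)) e)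
        (tendsto_const_nhds.congr' (hρ.mono fun ρ h => h.symm))
      rw [_root_.sum_apply] at hval
      simp only [dualLeft_apply, (he _).1] at hval
      exact hval
  refine ⟨l, hl, hmem.mono fun m hm => Submodule.le_topologicalClosure _ hm, fun a => ?_,
    fun a => ?_⟩
  · exact (continuous_fst.tendsto _).comp (hten a)
  · exact (continuous_snd.tendsto _).comp (hten a)

end PseudoAmenable

namespace IsProjectiveTensorProduct

variable {A B C : Type u} [NormedAddCommGroup A] [NormedSpace ℂ A]
  [NormedAddCommGroup B] [NormedSpace ℂ B]
  [NormedAddCommGroup C] [NormedSpace ℂ C] [CompleteSpace C] {tp : A →L[ℂ] B →L[ℂ] C}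

lemma exists_lift (htp : IsProjectiveTensorProduct tp) {Y : Type u} [NormedAddCommGroup Y]
    [NormedSpace ℂ Y] [CompleteSpace Y] (β : A →L[ℂ] B →L[ℂ] Y) :
    ∃ h : C →L[ℂ] Y, ∀ a b, h (tp a b) = β a b :=
  (htp.lift Y β).exists.imp fun _ h => h.1

/-- Bounded linear maps on `A ⊗_p B` are determined by their values on elementary tensors, if there
is some non-zero bounded bilinear map on `A × B`. -/
lemma ext (htp : IsProjectiveTensorProduct tp) {X Y : Type u} [NormedAddCommGroup X]
    [NormedSpace ℂ X] [CompleteSpace X] [NormedAddCommGroup Y] [NormedSpace ℂ Y] [CompleteSpace Y]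
    {β : A →L[ℂ] B →L[ℂ] X} (hβ : β ≠ 0) {h₁ h₂ : C →L[ℂ] Y}
    (h : ∀ a b, h₁ (tp a b) = h₂ (tp a b)) : h₁ = h₂ := by
  obtain ⟨k, hk, hkn⟩ := (htp.lift X β).exists
  set d := h₁ - h₂ with hd
  have hd0 : ∀ a b, d (tp a b) = 0 := fun a b => by simp [hd, h]
  have hpos : 0 < ‖β‖ := norm_pos_iff.2 hβ
  obtain ⟨ε, hε, hεd⟩ : ∃ ε : ℝ, 0 < ε ∧ ε * ‖d‖ ≤ ‖β‖ := by
    refine ⟨‖β‖ / (‖d‖ + 1), by positivity, ?_⟩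
    rw [div_mul_eq_mul_div, div_le_iff₀ (by positivity)]
    nlinarith [norm_nonneg d]
  let β' : A →L[ℂ] B →L[ℂ] X × Y := (compL ℂ B X (X × Y) (ContinuousLinearMap.inl ℂ X Y)).comp β
  have hβ' : ‖β‖ ≤ ‖β'‖ := by
    refine opNorm_le_bound₂ _ (norm_nonneg _) fun a b => ?_
    refine le_trans (le_of_eq ?_) (β'.le_opNorm₂ a b)
    change ‖β a b‖ = ‖(β a b, (0 : Y))‖
    simp [Prod.norm_def]
  have hprod : ∀ m : C →L[ℂ] Y, ‖m‖ ≤ ‖β‖ → ‖k.prod m‖ ≤ ‖β'‖ := by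
    intro m hm
    rw [ContinuousLinearMap.opNorm_prod, Prod.norm_def]
    exact (max_le hkn hm).trans hβ'
  have huniq := (htp.lift (X × Y) β').unique
    (y₁ := k.prod ((ε : ℂ) • d)) (y₂ := k.prod 0)
    ⟨fun a b => by
      change (k (tp a b), (ε : ℂ) • d (tp a b)) = (β a b, (0 : Y))
      rw [hk, hd0, smul_zero], hprod _ (by
      rw [norm_smul, Complex.norm_real, Real.norm_of_nonneg hε.le]
      exact hεd)⟩
    ⟨fun a b => by
      change (k (tp a b), (0 : Y)) = (β a b, (0 : Y))
      rw [hk], hprod _ (by simp)⟩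
  have hdz : d = 0 := by
    ext c
    have := congrArg (fun m : C →L[ℂ] X × Y => (m c).2) huniq
    have h2 : (ε : ℂ) • d c = 0 := this
    exact (smul_eq_zero.1 h2).resolve_left (by exact_mod_cast hε.ne')
  exact sub_eq_zero.1 hdz

/-- A version of `IsProjectiveTensorProduct.ext` for scalar-valued maps. -/
lemma ext_dual (htp : IsProjectiveTensorProduct tp) {X : Type u} [NormedAddCommGroup X]
    [NormedSpace ℂ X] [CompleteSpace X] {β : A →L[ℂ] B →L[ℂ] X} (hβ : β ≠ 0) {h₁ h₂ : C →L[ℂ] ℂ}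
    (h : ∀ a b, h₁ (tp a b) = h₂ (tp a b)) : h₁ = h₂ := by
  obtain ⟨x, hx⟩ : ∃ x : X, x ≠ 0 := by
    by_contra! h0
    exact hβ (by ext a b; exact h0 _)
  have := htp.ext hβ (h₁ := h₁.smulRight x) (h₂ := h₂.smulRight x) fun a b => by
    simp only [ContinuousLinearMap.smulRight_apply, h]
  ext c
  exact smul_left_injective ℂ hx (congrArg (fun m => m c) this)

/-- Bounded bilinear forms on `A ⊗_p B` are determined by their values on elementary tensors. -/
lemma ext_bilin (htp : IsProjectiveTensorProduct tp) {X : Type u} [NormedAddCommGroup X]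
    [NormedSpace ℂ X] [CompleteSpace X] {β : A →L[ℂ] B →L[ℂ] X} (hβ : β ≠ 0)
    {S₁ S₂ : C →L[ℂ] C →L[ℂ] ℂ}
    (h : ∀ a b a' b', S₁ (tp a b) (tp a' b') = S₂ (tp a b) (tp a' b')) : S₁ = S₂ :=
  htp.ext hβ fun a b => htp.ext_dual hβ fun a' b' => h a b a' b'

/-- Given a bilinear form `K` on `B` and a bilinear map `D` on `A`, there is a bilinear map on
`A ⊗_p B` with `(a ⊗ b, a' ⊗ b') ↦ K (b, b') D (a, a')`. -/
lemma exists_bilin (htp : IsProjectiveTensorProduct tp) {Y : Type u} [NormedAddCommGroup Y]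
    [NormedSpace ℂ Y] [CompleteSpace Y] (K : B →L[ℂ] B →L[ℂ] ℂ) (D : A →L[ℂ] A →L[ℂ] Y) :
    ∃ Ψ : C →L[ℂ] C →L[ℂ] Y, ∀ a b a' b', Ψ (tp a b) (tp a' b') = K b b' • D a a' := by
  let M : (A →L[ℂ] Y) →L[ℂ] (B →L[ℂ] ℂ) →L[ℂ] A →L[ℂ] B →L[ℂ] Y :=
    ((compL ℂ A Y (B →L[ℂ] Y)).comp (smulRightL ℂ B Y)).flip
  obtain ⟨α, hα⟩ := htp.exists_lift (M.bilinearComp D K)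
  let γ : A →L[ℂ] B →L[ℂ] C →L[ℂ] Y :=
    (flipₗᵢ ℂ C B Y : (C →L[ℂ] B →L[ℂ] Y) →L[ℂ] B →L[ℂ] C →L[ℂ] Y).comp α.flip
  obtain ⟨δ, hδ⟩ := htp.exists_lift γ
  refine ⟨δ.flip, fun a b a' b' => ?_⟩
  rw [ContinuousLinearMap.flip_apply, hδ]
  change α (tp a b) a' b' = _
  rw [hα]
  rfl

end IsProjectiveTensorProduct

lemma approximatelyBiflat_of_subsingleton (A : Type*) [NonUnitalNormedRing A] [NormedSpace ℂ A]
    [IsScalarTower ℂ A A] [SMulCommClass ℂ A A] [Subsingleton A] : ApproximatelyBiflat A := by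
  have hA : ∀ (f : Dual' A) (a : A), f a = 0 := fun f a => by
    rw [Subsingleton.elim a 0, map_zero]
  refine ⟨pure 0, inferInstance, ?_, fun f a => ?_⟩
  · rw [eventually_pure]
    exact fun a T => ⟨by ext x; simp only [hA], by ext x; simp only [hA]⟩
  · simp only [hA]
    exact tendsto_const_nhds

section Tensor

variable {A B C : Type u}
  [NonUnitalNormedRing A] [NormedSpace ℂ A] [IsScalarTower ℂ A A] [SMulCommClass ℂ A A]
  [CompleteSpace A]
  [NonUnitalNormedRing B] [NormedSpace ℂ B] [IsScalarTower ℂ B B] [SMulCommClass ℂ B B]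
  [NonUnitalNormedRing C] [NormedSpace ℂ C] [IsScalarTower ℂ C C] [SMulCommClass ℂ C C]
  [CompleteSpace C]

/-- Approximate biflatness passes from `A ⊗_p B` to `A`, if `A` is non-zero and `B` has a non-zero
idempotent. -/
lemma ApproximatelyBiflat.of_tensor [Nontrivial A]
    (tp : A →L[ℂ] B →L[ℂ] C) (htp : IsProjectiveTensorProduct tp)
    (hmul : ∀ (a a' : A) (b b' : B), tp a b * tp a' b' = tp (a * a') (b * b'))
    (b₀ : B) (hb₀ : b₀ ≠ 0) (hb₀idem : b₀ * b₀ = b₀)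
    (hC : ApproximatelyBiflat C) : ApproximatelyBiflat A := by
  obtain ⟨f, hf⟩ := SeparatingDual.exists_eq_one (R := ℂ) hb₀
  let F : Dual' B := dualLeft b₀ (dualRight b₀ f)
  have hF0 : F b₀ = 1 := by simp [F, hb₀idem, hf]
  have hFl : ∀ b, F (b₀ * b) = F b := fun b => by simp [F, ← mul_assoc, hb₀idem]
  have hFr : ∀ b, F (b * b₀) = F b := fun b => by simp [F, mul_assoc, hb₀idem]
  let β : A →L[ℂ] B →L[ℂ] A := (smulRightL ℂ B A F)
  have hβ_apply : ∀ a b, β a b = F b • a := fun a b => rfl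
  have hβ : β ≠ 0 := by
    intro h0
    obtain ⟨a, ha⟩ := exists_ne (0 : A)
    exact ha (by simpa [hF0, h0] using (hβ_apply a b₀).symm)
  obtain ⟨Φ, hΦ⟩ := htp.exists_lift β
  obtain ⟨Ψ, hΨ⟩ := htp.exists_bilin (piStar F) (dyadL (A := A))
  let Θ : BilForm A →L[ℂ] BilForm C :=
    ((flipₗᵢ ℂ (BilForm A) C ℂ).symm :
      (C →L[ℂ] BilForm A →L[ℂ] ℂ) →L[ℂ] BilForm A →L[ℂ] C →L[ℂ] ℂ).comp Ψ |>.flip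
  have hΘ : ∀ T a b a' b', Θ T (tp a b) (tp a' b') = F (b * b') * T a a' := by
    intro T a b a' b'
    change Ψ (tp a b) (tp a' b') T = _
    rw [hΨ]
    rfl
  let j : A →L[ℂ] C := tp.flip b₀
  have hj : ∀ a, j a = tp a b₀ := fun a => rfl
  have hjmul : ∀ a a', j a * j a' = j (a * a') := fun a a' => by simp only [hj, hmul, hb₀idem]
  have hΘl : ∀ a T, Θ (bilLeft a T) = bilLeft (j a) (Θ T) := fun a T =>
    htp.ext_bilin hβ fun x b y b' => by
      rw [hΘ, bilLeft_apply, bilLeft_apply, hj, hmul, hΘ, ← mul_assoc, hFr]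
  have hΘr : ∀ a T, Θ (bilRight a T) = bilRight (j a) (Θ T) := fun a T =>
    htp.ext_bilin hβ fun x b y b' => by
      rw [hΘ, bilRight_apply, bilRight_apply, hj, hmul, hΘ, mul_assoc, hFl]
  have hΘπ : ∀ g : Dual' A, Θ (piStar g) = piStar (g.comp Φ) := fun g =>
    htp.ext_bilin hβ fun x b y b' => by
      rw [hΘ, piStar_apply, piStar_apply, hmul, ContinuousLinearMap.comp_apply, hΦ, hβ_apply,
        map_smul, smul_eq_mul]
  obtain ⟨l, hl, hbim, hlim⟩ := hC
  let R : (BilForm C →L[ℂ] Dual' C) → BilForm A →L[ℂ] Dual' A :=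
    fun ρ => ((compL ℂ A C ℂ).flip j).comp (ρ.comp Θ)
  have hR : ∀ ρ T x, R ρ T x = ρ (Θ T) (j x) := fun ρ T x => rfl
  refine ⟨l.map R, hl.map R, ?_, fun g a => ?_⟩
  · rw [eventually_map]
    filter_upwards [hbim] with ρ hρ a T
    constructor
    · ext x
      rw [hR, hΘl, (hρ _ _).1, dualLeft_apply, dualLeft_apply, hR, hjmul]
    · ext x
      rw [hR, hΘr, (hρ _ _).2, dualRight_apply, dualRight_apply, hR, hjmul]
  · rw [tendsto_map'_iff]
    have := hlim (g.comp Φ) (j a)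
    rw [ContinuousLinearMap.comp_apply, hj, hΦ, hβ_apply, hF0, one_smul] at this
    refine this.congr fun ρ => ?_
    rw [Function.comp_apply, hR, hΘπ, hj]

end Tensor

/-- Let `A` and `B` be Banach algebras such that `A` has an identity and `B`
has a non-zero idempotent element.  If the projective tensor product `A ⊗_p B` is approximately
biflat, then `A` is approximately biflat, and consequently `A` is pseudo-amenable. -/
theorem statement7 {A B C : Type u}
    [NonUnitalNormedRing A] [NormedSpace ℂ A] [IsScalarTower ℂ A A] [SMulCommClass ℂ A A]
    [CompleteSpace A]
    [NonUnitalNormedRing B] [NormedSpace ℂ B] [IsScalarTower ℂ B B] [SMulCommClass ℂ B B]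
    [CompleteSpace B]
    [NonUnitalNormedRing C] [NormedSpace ℂ C] [IsScalarTower ℂ C C] [SMulCommClass ℂ C C]
    [CompleteSpace C]
    (tp : A →L[ℂ] B →L[ℂ] C) (htp : IsProjectiveTensorProduct tp)
    (hmul : ∀ (a a' : A) (b b' : B), tp a b * tp a' b' = tp (a * a') (b * b'))
    (e : A) (he : ∀ a : A, e * a = a ∧ a * e = a)
    (b₀ : B) (hb₀ : b₀ ≠ 0) (hb₀idem : b₀ * b₀ = b₀)
    (hC : ApproximatelyBiflat C) :
    ApproximatelyBiflat A ∧ PseudoAmenable A := by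
  have hA : ApproximatelyBiflat A := by
    rcases subsingleton_or_nontrivial A with _ | _
    · exact approximatelyBiflat_of_subsingleton A
    · exact ApproximatelyBiflat.of_tensor tp htp hmul b₀ hb₀ hb₀idem hC
  exact ⟨hA, hA.pseudoAmenable e he⟩

end ApproxBiflat
end
end

section
/- Let S be an inverse semigroup such that the set of idempotents E(S) is uniformly locally finite. Then the semigroup algebra ℓ¹(S) is approximately biflat if and only if ℓ¹(S) is biflat. -/
set_option synthInstance.maxHeartbeats 1000000
set_option maxHeartbeats 4000000
set_option maxSynthPendingDepth 3
set_option linter.unusedSectionVars false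
set_option linter.unusedVariables false
open scoped Topology
open Filter ContinuousLinearMap

noncomputable section

namespace ApproxBiflat

/-- An inverse semigroup: a semigroup in which every element `s` has a unique inverse `s*`.
We use the standard equational axiomatization (a semigroup with an involution `star` such that
`s s* s = s` and all idempotents `s s*` commute); the remaining fields (`star_mul`, `star_idem`)
are derivable properties, included for convenience. -/
class InverseSemigroup (S : Type*) extends Semigroup S, Star S where
  mul_star_mul : ∀ a : S, a * star a * a = a
  star_star : ∀ a : S, star (star a) = a
  star_mul : ∀ a b : S, star (a * b) = star b * star a
  idem_comm : ∀ a b : S, (a * star a) * (b * star b) = (b * star b) * (a * star a)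
  star_idem : ∀ e : S, e * e = e → star e = e

/-- The set of idempotents `E(S)` of `S` is *uniformly locally finite*:
`sup { |(x]| : x ∈ E(S) } < ∞`, where `(x] = { y ∈ E(S) : y ≤ x }` and
`y ≤ x ⟺ y = yx = xy` is the canonical partial order on `E(S)`. -/
def IdempotentsUniformlyLocallyFinite (S : Type*) [Mul S] : Prop :=
  ∃ n : ℕ, ∀ e : S, e * e = e →
    {f : S | f * f = f ∧ f * e = f ∧ e * f = f}.Finite ∧
      {f : S | f * f = f ∧ f * e = f ∧ e * f = f}.ncard ≤ n

variable {S : Type*} [InverseSemigroup S]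

private lemma maxSubgroup_mul_mem {p a b : S} (hp : p * p = p)
    (ha1 : a * star a = p) (ha2 : star a * a = p)
    (hb1 : b * star b = p) (hb2 : star b * b = p) :
    (a * b) * star (a * b) = p ∧ star (a * b) * (a * b) = p := by
  constructor
  · have h : (a * b) * star (a * b) = a * (b * star b) * star a := by
      rw [InverseSemigroup.star_mul]; simp only [mul_assoc]
    rw [h, hb1]
    calc a * p * star a = a * (star a * a) * star a := by rw [ha2]
      _ = a * star a * (a * star a) := by simp only [mul_assoc]
      _ = p := by rw [ha1, hp]
  · have h : star (a * b) * (a * b) = star b * (star a * a) * b := by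
      rw [InverseSemigroup.star_mul]; simp only [mul_assoc]
    rw [h, ha2]
    calc star b * p * b = star b * (b * star b) * b := by rw [hb1]
      _ = star b * b * (star b * b) := by simp only [mul_assoc]
      _ = p := by rw [hb2, hp]

/-- The maximal subgroup `G_p = { s ∈ S : s s* = s* s = p }` of `S` at an idempotent `p`. -/
def MaxSubgroup (p : S) : Type _ := {s : S // s * star s = p ∧ star s * s = p}

/-- `G_p` is a group (with identity `p` and inversion `s ↦ s*`). -/
def maxSubgroupGroup (p : S) (hp : p * p = p) : Group (MaxSubgroup p) where
  mul s t := ⟨s.1 * t.1, maxSubgroup_mul_mem hp s.2.1 s.2.2 t.2.1 t.2.2⟩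
  mul_assoc s t u := Subtype.ext (mul_assoc s.1 t.1 u.1)
  one := ⟨p, by rw [InverseSemigroup.star_idem p hp]; exact ⟨hp, hp⟩⟩
  one_mul s := by
    obtain ⟨a, h1, h2⟩ := s
    apply Subtype.ext
    show p * a = a
    rw [← h1]; exact InverseSemigroup.mul_star_mul a
  mul_one s := by
    obtain ⟨a, h1, h2⟩ := s
    apply Subtype.ext
    show a * p = a
    rw [← h2, ← mul_assoc]; exact InverseSemigroup.mul_star_mul a
  inv s := ⟨star s.1, by
    rw [InverseSemigroup.star_star]
    exact ⟨s.2.2, s.2.1⟩⟩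
  inv_mul_cancel s := by
    obtain ⟨a, h1, h2⟩ := s
    apply Subtype.ext
    show star a * a = p
    exact h2

end ApproxBiflat
namespace ApproxBiflat

open scoped ENNReal

section Semigroup

variable {S : Type*} [InverseSemigroup S]

/-- The source idempotent `s* s`. -/
def src (s : S) : S := star s * s

/-- The range idempotent `s s*`. -/
def rng (s : S) : S := s * star s

lemma rng_mul (s : S) : rng s * s = s := InverseSemigroup.mul_star_mul s

lemma mul_src (s : S) : s * src s = s := by
  rw [src, ← mul_assoc]; exact InverseSemigroup.mul_star_mul s

lemma src_star (s : S) : src (star s) = rng s := by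
  rw [src, rng, InverseSemigroup.star_star]

lemma rng_star (s : S) : rng (star s) = src s := by
  rw [src, rng, InverseSemigroup.star_star]

lemma rng_idem (s : S) : rng s * rng s = rng s := by
  nth_rw 2 [rng]
  rw [← mul_assoc, rng_mul, rng]

lemma src_idem (s : S) : src s * src s = src s := by
  rw [← rng_star, rng_idem]

lemma star_mul_rng (s : S) : star s * rng s = star s := by
  rw [← src_star, mul_src]

lemma rng_of_idem {f : S} (hf : f * f = f) : rng f = f := by
  rw [rng, InverseSemigroup.star_idem f hf, hf]

lemma src_of_idem {f : S} (hf : f * f = f) : src f = f := by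
  rw [src, InverseSemigroup.star_idem f hf, hf]

lemma idem_mul_comm {f g : S} (hf : f * f = f) (hg : g * g = g) : f * g = g * f := by
  have := InverseSemigroup.idem_comm f g
  change rng f * rng g = rng g * rng f at this
  rwa [rng_of_idem hf, rng_of_idem hg] at this

lemma src_mul {s t : S} (h : src s = rng t) : src (s * t) = src t := by
  have : src (s * t) = star t * src s * t := by
    simp only [src, InverseSemigroup.star_mul, mul_assoc]
  rw [this, h, star_mul_rng, src]

lemma rng_mul_eq {s t : S} (h : src s = rng t) : rng (s * t) = rng s := by
  have : rng (s * t) = s * rng t * star s := by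
    simp only [rng, InverseSemigroup.star_mul, mul_assoc]
  rw [this, ← h, mul_src, rng]

/-- The natural partial order of an inverse semigroup. -/
def NatLE (a s : S) : Prop := s * src a = a

lemma NatLE.refl (s : S) : NatLE s s := mul_src s

lemma NatLE.src_mul_src {a s : S} (h : NatLE a s) : src s * src a = src a := by
  have h1 : src a = src a * (src s * src a) := by
    conv_lhs => rw [src, ← h, InverseSemigroup.star_mul,
      InverseSemigroup.star_idem _ (src_idem a)]
    simp only [src, mul_assoc]
  calc src s * src a = src s * src a * src a := by rw [mul_assoc, src_idem]
    _ = src a * (src s * src a) := by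
      rw [← mul_assoc, idem_mul_comm (src_idem a) (src_idem s)]
    _ = src a := h1.symm

lemma NatLE.rng_mul {a s : S} (h : NatLE a s) : rng a * s = a := by
  have h1 : rng a = s * src a * star s := by
    conv_lhs => rw [rng, ← h, InverseSemigroup.star_mul,
      InverseSemigroup.star_idem _ (src_idem a)]
    rw [← mul_assoc, mul_assoc s, src_idem]
  rw [h1, mul_assoc, ← src, mul_assoc, idem_mul_comm (src_idem a) (src_idem s), ← mul_assoc,
    mul_src, h]

lemma natLE_of_eq_mul {a s f : S} (hf : f * f = f) (h : s * f = a) : NatLE a s := by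
  have h1 : src a = f * src s * f := by
    rw [src, ← h, InverseSemigroup.star_mul, InverseSemigroup.star_idem _ hf]
    simp only [src, mul_assoc]
  rw [NatLE, h1, idem_mul_comm hf (src_idem s), ← mul_assoc, ← mul_assoc, mul_src, mul_assoc,
    hf, h]

lemma natLE_of_eq_mul' {a s f : S} (hf : f * f = f) (h : f * s = a) : NatLE a s := by
  have hg : (star s * f * s) * (star s * f * s) = star s * f * s := by
    have : (star s * f * s) * (star s * f * s) = star s * (f * rng s) * f * s := by
      simp only [rng, mul_assoc]
    rw [this, idem_mul_comm hf (rng_idem s), ← mul_assoc, star_mul_rng, mul_assoc (star s), hf]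
  refine natLE_of_eq_mul hg ?_
  have : s * (star s * f * s) = rng s * f * s := by simp only [rng, mul_assoc]
  rw [this, idem_mul_comm (rng_idem s) hf, mul_assoc, ApproxBiflat.rng_mul, h]

lemma NatLE.trans {a b c : S} (h : NatLE a b) (h' : NatLE b c) : NatLE a c := by
  refine natLE_of_eq_mul (src_idem a) ?_
  rw [← h.src_mul_src, ← mul_assoc, h', h]

lemma NatLE.antisymm {a b : S} (h : NatLE a b) (h' : NatLE b a) : a = b := by
  have h1 : src a = src b := by
    rw [← h.src_mul_src, idem_mul_comm (src_idem b) (src_idem a), h'.src_mul_src]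
  rw [← h, h1, mul_src]

lemma natLE_src_inj {a b s : S} (ha : NatLE a s) (hb : NatLE b s) (h : src a = src b) :
    a = b := by
  rw [← ha, ← hb, h]

/-- Every element below a product factors as a composable product. -/
lemma exists_factor {s t c : S} (h : NatLE c (s * t)) :
    NatLE (rng c * s) s ∧ NatLE (t * src c) t ∧ src (rng c * s) = rng (t * src c) ∧
      (rng c * s) * (t * src c) = c := by
  refine ⟨natLE_of_eq_mul' (rng_idem c) rfl, natLE_of_eq_mul (src_idem c) rfl, ?_, ?_⟩
  · have hX : src (rng c * s) = star s * rng c * s := by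
      rw [src, InverseSemigroup.star_mul, InverseSemigroup.star_idem _ (rng_idem c), ← mul_assoc,
        mul_assoc (star s), rng_idem]
    have hY : rng (t * src c) = t * src c * star t := by
      rw [rng, InverseSemigroup.star_mul, InverseSemigroup.star_idem _ (src_idem c), ← mul_assoc,
        mul_assoc t, src_idem]
    have hr : rng c = s * (t * src c * star t) * star s := by
      conv_lhs => rw [rng, ← h, InverseSemigroup.star_mul, InverseSemigroup.star_mul,
        InverseSemigroup.star_idem _ (src_idem c)]
      simp only [mul_assoc]
      rw [← mul_assoc (src c) (src c), src_idem]
    have hs : src c = star t * (star s * rng c * s) * t := by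
      conv_lhs => rw [src, ← h.rng_mul, InverseSemigroup.star_mul, InverseSemigroup.star_mul,
        InverseSemigroup.star_idem _ (rng_idem c)]
      simp only [mul_assoc]
      rw [← mul_assoc (rng c) (rng c), rng_idem]
    have h1 : src (rng c * s) = src s * rng (t * src c) * src s := by
      rw [hX, hY]; conv_lhs => rw [hr]
      simp only [src, mul_assoc]
    have h2 : rng (t * src c) = rng t * src (rng c * s) * rng t := by
      rw [hX, hY]; conv_lhs => rw [hs]
      simp only [rng, mul_assoc]
    have iX := src_idem (rng c * s)
    have iY := rng_idem (t * src c)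
    generalize src (rng c * s) = X at *
    generalize rng (t * src c) = Y at *
    have h1' : X = Y * src s := by
      rw [h1, idem_mul_comm (src_idem s) iY, mul_assoc, src_idem]
    have h2' : Y = X * rng t := by
      rw [h2, idem_mul_comm (rng_idem t) iX, mul_assoc, rng_idem]
    have e1 : Y * X = X := by
      conv_rhs => rw [h1', ← iY, mul_assoc, ← h1']
    have e2 : X * Y = Y := by
      conv_rhs => rw [h2', ← iX, mul_assoc, ← h2']
    rw [← e1, idem_mul_comm iY iX, e2]
  · have : (rng c * s) * (t * src c) = rng c * (s * t * src c) := by simp only [mul_assoc]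
    rw [this, h, ApproxBiflat.rng_mul]

lemma factor_unique {s t a b : S} (ha : NatLE a s) (hb : NatLE b t) (h : src a = rng b) :
    NatLE (a * b) (s * t) ∧ rng (a * b) * s = a ∧ t * src (a * b) = b := by
  have h2 : t * src (a * b) = b := by rw [src_mul h, hb]
  refine ⟨?_, ?_, h2⟩
  · calc s * t * src (a * b) = s * (rng b * b) := by rw [mul_assoc, h2, ApproxBiflat.rng_mul]
      _ = a * b := by rw [← h, ← mul_assoc, ha]
  · rw [rng_mul_eq h, ha.rng_mul]

lemma finite_natLE {n : ℕ} (h : ∀ f : S, f * f = f →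
    {g : S | g * g = g ∧ g * f = g ∧ f * g = g}.Finite ∧
      {g : S | g * g = g ∧ g * f = g ∧ f * g = g}.ncard ≤ n) (s : S) :
    {a : S | NatLE a s}.Finite ∧ {a : S | NatLE a s}.ncard ≤ n := by
  obtain ⟨hf, hn⟩ := h (src s) (src_idem s)
  have hm : Set.MapsTo src {a : S | NatLE a s}
      {g : S | g * g = g ∧ g * src s = g ∧ src s * g = g} := fun a ha =>
    ⟨src_idem a, by rw [idem_mul_comm (src_idem a) (src_idem s), NatLE.src_mul_src ha],
      NatLE.src_mul_src ha⟩
  have hi : Set.InjOn src {a : S | NatLE a s} := fun a ha b hb hab => natLE_src_inj ha hb hab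
  exact ⟨Set.Finite.of_injOn hm hi hf, (Set.ncard_le_ncard_of_injOn _ hm hi hf).trans hn⟩

end Semigroup

section Modulus

variable {X : Type*}

/-- `m` is linear on the bounded functions on `X`, with norm at most `B` for the sup norm. -/
structure IsBoundedFunctional (m : (X → ℂ) → ℂ) (B : ℝ) : Prop where
  nonneg : 0 ≤ B
  add : ∀ (φ ψ : X → ℂ) (C : ℝ), (∀ x, ‖φ x‖ ≤ C) → (∀ x, ‖ψ x‖ ≤ C) → m (φ + ψ) = m φ + m ψ
  smul : ∀ (c : ℂ) (φ : X → ℂ) (C : ℝ), (∀ x, ‖φ x‖ ≤ C) → m (c • φ) = c * m φ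
  bound : ∀ (φ : X → ℂ) (C : ℝ), 0 ≤ C → (∀ x, ‖φ x‖ ≤ C) → ‖m φ‖ ≤ B * C

lemma IsBoundedFunctional.map_zero {m : (X → ℂ) → ℂ} {B : ℝ} (hm : IsBoundedFunctional m B) :
    m 0 = 0 := by
  have := hm.smul 0 0 0 (by simp)
  simpa using this

/-- The modulus `|m|` of a functional `m`, evaluated at a nonnegative function. -/
def modulus (m : (X → ℂ) → ℂ) (f : X → ℝ) : ℝ :=
  sSup {r : ℝ | ∃ g : X → ℂ, (∀ x, ‖g x‖ ≤ f x) ∧ r = ‖m g‖}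

variable {m : (X → ℂ) → ℂ} {B : ℝ} {f f' : X → ℝ} {C : ℝ}

lemma modulus_nonneg (m : (X → ℂ) → ℂ) (f : X → ℝ) : 0 ≤ modulus m f := by
  apply Real.sSup_nonneg
  rintro _ ⟨g, -, rfl⟩
  exact norm_nonneg _

lemma norm_le_modulus (hm : IsBoundedFunctional m B) (hf : ∀ x, f x ≤ C) {g : X → ℂ}
    (hg : ∀ x, ‖g x‖ ≤ f x) : ‖m g‖ ≤ modulus m f := by
  refine le_csSup ⟨B * max C 0, ?_⟩ ⟨g, hg, rfl⟩
  rintro _ ⟨g', hg', rfl⟩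
  exact hm.bound _ _ (le_max_right _ _) fun x => ((hg' x).trans (hf x)).trans (le_max_left _ _)

lemma modulus_le (hf0 : ∀ x, 0 ≤ f x) {D : ℝ}
    (h : ∀ g : X → ℂ, (∀ x, ‖g x‖ ≤ f x) → ‖m g‖ ≤ D) : modulus m f ≤ D := by
  refine csSup_le ⟨‖m 0‖, 0, by simpa using hf0, rfl⟩ ?_
  rintro _ ⟨g, hg, rfl⟩
  exact h g hg

lemma modulus_mono (hm : IsBoundedFunctional m B) (hf0 : ∀ x, 0 ≤ f x) (hff : ∀ x, f x ≤ f' x)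
    (hf' : ∀ x, f' x ≤ C) : modulus m f ≤ modulus m f' :=
  modulus_le hf0 fun _ hg => norm_le_modulus hm hf' fun x => (hg x).trans (hff x)

lemma exists_phase (z : ℂ) : ∃ c : ℂ, ‖c‖ = 1 ∧ c * z = ‖z‖ := by
  by_cases hz : z = 0
  · exact ⟨1, by simp, by simp [hz]⟩
  · refine ⟨‖z‖ / z, by simp [hz], by field_simp⟩

lemma modulus_add (hm : IsBoundedFunctional m B) (hf0 : ∀ x, 0 ≤ f x) (hf'0 : ∀ x, 0 ≤ f' x)
    (hf : ∀ x, f x ≤ C) (hf' : ∀ x, f' x ≤ C) :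
    modulus m (f + f') = modulus m f + modulus m f' := by
  have hs0 : ∀ x, 0 ≤ (f + f') x := fun x => add_nonneg (hf0 x) (hf'0 x)
  have hs : ∀ x, (f + f') x ≤ C + C := fun x => add_le_add (hf x) (hf' x)
  apply le_antisymm
  · refine modulus_le hs0 fun g hg => ?_
    have key : ∀ k : X → ℝ, (∀ x, 0 ≤ k x) →
        ∀ x, ‖g x * ((k x / (f x + f' x) : ℝ) : ℂ)‖ ≤ k x := by
      intro k hk x
      have hg' : ‖g x‖ ≤ f x + f' x := hg x
      rw [norm_mul, Complex.norm_real, Real.norm_of_nonneg (div_nonneg (hk x) (show 0 ≤ f x + f' x from hs0 x))]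
      rcases (hs0 x).eq_or_lt with h0 | h0
      · have : f x + f' x = 0 := h0.symm
        rw [this, div_zero, mul_zero]; exact hk x
      · have h0' : 0 < f x + f' x := h0
        calc ‖g x‖ * (k x / (f x + f' x)) ≤ (f x + f' x) * (k x / (f x + f' x)) := by
              gcongr
              exact div_nonneg (hk x) h0'.le
          _ = k x := by field_simp
    have h1 := key f hf0
    have h2 := key f' hf'0
    have hsum : g = (fun x => g x * ((f x / (f x + f' x) : ℝ) : ℂ)) +
        (fun x => g x * ((f' x / (f x + f' x) : ℝ) : ℂ)) := by
      funext x
      have hg' : ‖g x‖ ≤ f x + f' x := hg x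
      rw [Pi.add_apply, ← mul_add, ← Complex.ofReal_add, ← add_div]
      by_cases h0 : f x + f' x = 0
      · rw [h0] at hg'
        simp [norm_le_zero_iff.mp hg']
      · simp [div_self h0]
    rw [hsum, hm.add _ _ C (fun x => (h1 x).trans (hf x)) (fun x => (h2 x).trans (hf' x))]
    exact (norm_add_le _ _).trans (add_le_add (norm_le_modulus hm hf h1)
      (norm_le_modulus hm hf' h2))
  · rw [← le_sub_iff_add_le]
    refine modulus_le hf0 fun g hg => ?_
    rw [le_sub_comm]
    refine modulus_le hf'0 fun g' hg' => ?_
    rw [le_sub_iff_add_le]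
    obtain ⟨c, hc, hcm⟩ := exists_phase (m g)
    obtain ⟨c', hc', hcm'⟩ := exists_phase (m g')
    have hgC : ∀ x, ‖g x‖ ≤ C := fun x => (hg x).trans (hf x)
    have hgC' : ∀ x, ‖g' x‖ ≤ C := fun x => (hg' x).trans (hf' x)
    have hb : ∀ x, ‖(c' • g' + c • g) x‖ ≤ (f + f') x := fun x => by
      refine (norm_add_le _ _).trans ?_
      simp only [Pi.smul_apply, norm_smul, hc, hc', one_mul, Pi.add_apply]
      linarith [hg x, hg' x]
    have := norm_le_modulus hm hs hb
    rw [hm.add _ _ C (by simpa [norm_smul, hc'] using hgC') (by simpa [norm_smul, hc] using hgC),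
      hm.smul _ _ C hgC, hm.smul _ _ C hgC', hcm, hcm', ← Complex.ofReal_add,
      Complex.norm_real, Real.norm_of_nonneg (by positivity)] at this
    exact this

lemma modulus_smul_le (hm : IsBoundedFunctional m B) (hf0 : ∀ x, 0 ≤ f x) (hf : ∀ x, f x ≤ C)
    {c : ℝ} (hc : 0 < c) : modulus m (c • f) ≤ c * modulus m f := by
  refine modulus_le (fun x => mul_nonneg hc.le (hf0 x)) fun g hg => ?_
  have hg' : ∀ x, ‖((c⁻¹ : ℂ) • g) x‖ ≤ f x := fun x => by
    have : ‖g x‖ ≤ c * f x := hg x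
    rw [Pi.smul_apply, norm_smul, norm_inv, Complex.norm_real, Real.norm_of_nonneg hc.le,
      inv_mul_le_iff₀ hc]
    exact this
  have h := norm_le_modulus hm hf hg'
  rw [hm.smul _ _ (c * C) (fun x => (hg x).trans (mul_le_mul_of_nonneg_left (hf x) hc.le)),
    norm_mul, norm_inv, Complex.norm_real, Real.norm_of_nonneg hc.le, inv_mul_le_iff₀ hc] at h
  exact h

lemma modulus_zero (hm : IsBoundedFunctional m B) : modulus m 0 = 0 := by
  refine le_antisymm (modulus_le (by simp) fun g hg => ?_) (modulus_nonneg _ _)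
  have : g = 0 := funext fun x => norm_le_zero_iff.mp (hg x)
  simp [this, hm.map_zero]

lemma modulus_smul (hm : IsBoundedFunctional m B) (hf0 : ∀ x, 0 ≤ f x) (hf : ∀ x, f x ≤ C)
    {c : ℝ} (hc : 0 ≤ c) : modulus m (c • f) = c * modulus m f := by
  rcases hc.eq_or_lt with rfl | hc
  · simp [modulus_zero hm]
  · refine le_antisymm (modulus_smul_le hm hf0 hf hc) ?_
    have h := modulus_smul_le hm (f := c • f) (C := c * C) (fun x => mul_nonneg hc.le (hf0 x))
      (fun x => mul_le_mul_of_nonneg_left (hf x) hc.le) (inv_pos.mpr hc)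
    rwa [smul_smul, inv_mul_cancel₀ hc.ne', one_smul, le_inv_mul_iff₀ hc] at h

/-- The real-linear extension of the modulus to bounded real functions. -/
def modulusReal (m : (X → ℂ) → ℂ) (f : X → ℝ) : ℝ :=
  modulus m (fun x => max (f x) 0) - modulus m (fun x => max (-f x) 0)

lemma max_bounds {f : X → ℝ} {C : ℝ} (hf : ∀ x, |f x| ≤ C) :
    (∀ x, 0 ≤ max (f x) 0) ∧ (∀ x, max (f x) 0 ≤ C) ∧ (∀ x, 0 ≤ max (-f x) 0) ∧
      ∀ x, max (-f x) 0 ≤ C :=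
  ⟨fun _ => le_max_right _ _,
    fun x => max_le ((le_abs_self _).trans (hf x)) ((abs_nonneg _).trans (hf x)),
    fun _ => le_max_right _ _,
    fun x => max_le ((neg_le_abs _).trans (hf x)) ((abs_nonneg _).trans (hf x))⟩

lemma modulusReal_add (hm : IsBoundedFunctional m B) (hf : ∀ x, |f x| ≤ C)
    (hf' : ∀ x, |f' x| ≤ C) :
    modulusReal m (f + f') = modulusReal m f + modulusReal m f' := by
  have hs : ∀ x, |(f + f') x| ≤ C + C := fun x =>
    (abs_add_le _ _).trans (add_le_add (hf x) (hf' x))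
  obtain ⟨a1, a2, a3, a4⟩ := max_bounds hf
  obtain ⟨b1, b2, b3, b4⟩ := max_bounds hf'
  obtain ⟨c1, c2, c3, c4⟩ := max_bounds hs
  have h2 : ∀ {k : X → ℝ}, (∀ x, k x ≤ C) → ∀ x, k x ≤ max C (C + C) :=
    fun h x => (h x).trans (le_max_left _ _)
  have h3 : ∀ {k : X → ℝ}, (∀ x, k x ≤ C + C) → ∀ x, k x ≤ max C (C + C) :=
    fun h x => (h x).trans (le_max_right _ _)
  have e1 := modulus_add hm a1 b1 a2 b2
  have e2 := modulus_add hm a3 b3 a4 b4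
  have e3 := modulus_add hm (fun x => add_nonneg (a1 x) (b1 x)) c3
    (fun x => add_le_add (a2 x) (b2 x)) c4
  have e4 := modulus_add hm (fun x => add_nonneg (a3 x) (b3 x)) c1
    (fun x => add_le_add (a4 x) (b4 x)) c2
  have e : (fun x => max (f x) 0 + max (f' x) 0) + (fun x => max (-(f + f') x) 0) =
      (fun x => max (-f x) 0 + max (-f' x) 0) + (fun x => max ((f + f') x) 0) := by
    funext x
    simp only [Pi.add_apply]
    have key : ∀ y : ℝ, max y 0 - max (-y) 0 = y := fun y => by
      rcases le_total y 0 with h | h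
      · rw [max_eq_right h, max_eq_left (by linarith)]; ring
      · rw [max_eq_left h, max_eq_right (by linarith)]; ring
    linarith [key (f x), key (f' x), key (f x + f' x)]
  rw [e] at e3
  unfold modulusReal
  change modulus m (fun x => max (f x) 0 + max (f' x) 0) = _ at e1
  change modulus m (fun x => max (-f x) 0 + max (-f' x) 0) = _ at e2
  linarith

lemma modulusReal_neg (m : (X → ℂ) → ℂ) (f : X → ℝ) :
    modulusReal m (-f) = -modulusReal m f := by
  simp [modulusReal]

lemma modulusReal_smul (hm : IsBoundedFunctional m B) (hf : ∀ x, |f x| ≤ C) (c : ℝ) :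
    modulusReal m (c • f) = c * modulusReal m f := by
  have pos : ∀ c : ℝ, 0 ≤ c → modulusReal m (c • f) = c * modulusReal m f := by
    intro c hc
    obtain ⟨a1, a2, a3, a4⟩ := max_bounds hf
    have e1 : (fun x => max ((c • f) x) 0) = c • fun x => max (f x) 0 := by
      funext x; simp [mul_max_of_nonneg _ _ hc]
    have e2 : (fun x => max (-(c • f) x) 0) = c • fun x => max (-f x) 0 := by
      funext x; simp [mul_max_of_nonneg _ _ hc]
    rw [modulusReal, e1, e2, modulus_smul hm a1 a2 hc, modulus_smul hm a3 a4 hc, modulusReal]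
    ring
  rcases le_total 0 c with hc | hc
  · exact pos c hc
  · have h := pos (-c) (by linarith)
    rw [neg_smul, modulusReal_neg] at h
    linarith

lemma abs_modulusReal_le (hm : IsBoundedFunctional m B) (hC : 0 ≤ C) (hf : ∀ x, |f x| ≤ C) :
    |modulusReal m f| ≤ modulus m 1 * C := by
  obtain ⟨a1, a2, a3, a4⟩ := max_bounds hf
  have key : ∀ k : X → ℝ, (∀ x, 0 ≤ k x) → (∀ x, k x ≤ C) → modulus m k ≤ modulus m 1 * C := by
    intro k h0 hk
    rw [mul_comm, ← modulus_smul hm (f := 1) (C := 1) (by simp) (by simp) hC]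
    exact modulus_mono hm h0 (by simpa using hk) (C := C) (by simp)
  have := key _ a1 a2
  have := key _ a3 a4
  have := modulus_nonneg m (fun x => max (f x) 0)
  have := modulus_nonneg m (fun x => max (-f x) 0)
  rw [modulusReal, abs_le]
  constructor <;> linarith

/-- The complex-linear extension of the modulus, normalized to take the value `1` at `1`. -/
def meanOf (m : (X → ℂ) → ℂ) (φ : X → ℂ) : ℂ :=
  (modulusReal m (fun x => (φ x).re) + Complex.I * modulusReal m (fun x => (φ x).im)) /
    modulus m 1

lemma isBoundedFunctional_meanOf (hm : IsBoundedFunctional m B) :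
    IsBoundedFunctional (meanOf m) 2 := by
  have hre : ∀ {φ : X → ℂ} {C : ℝ}, (∀ x, ‖φ x‖ ≤ C) → ∀ x, |(φ x).re| ≤ C :=
    fun h x => (Complex.abs_re_le_norm _).trans (h x)
  have him : ∀ {φ : X → ℂ} {C : ℝ}, (∀ x, ‖φ x‖ ≤ C) → ∀ x, |(φ x).im| ≤ C :=
    fun h x => (Complex.abs_im_le_norm _).trans (h x)
  refine ⟨by norm_num, ?_, ?_, ?_⟩
  · intro φ ψ C hφ hψ
    have h1 := modulusReal_add hm (hre hφ) (hre hψ)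
    have h2 := modulusReal_add hm (him hφ) (him hψ)
    simp only [meanOf, Pi.add_apply, Complex.add_re, Complex.add_im]
    rw [← add_div]
    congr 1
    change (modulusReal m ((fun x => (φ x).re) + fun x => (ψ x).re) : ℂ) +
      Complex.I * modulusReal m ((fun x => (φ x).im) + fun x => (ψ x).im) = _
    rw [h1, h2]; push_cast; ring
  · intro c φ C hφ
    have e1 : (fun x => ((c • φ) x).re) = c.re • (fun x => (φ x).re) +
        (-c.im) • (fun x => (φ x).im) := by
      funext x; simp [sub_eq_add_neg]
    have e2 : (fun x => ((c • φ) x).im) = c.re • (fun x => (φ x).im) +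
        c.im • (fun x => (φ x).re) := by
      funext x; simp
    have hb : ∀ (a : ℝ), |a| ≤ ‖c‖ → ∀ k : X → ℝ, (∀ x, |k x| ≤ C) →
        ∀ x, |(a • k) x| ≤ ‖c‖ * C := by
      intro a ha k hk x
      rw [Pi.smul_apply, smul_eq_mul, abs_mul]
      exact mul_le_mul ha (hk x) (abs_nonneg _) (norm_nonneg _)
    have hcr := Complex.abs_re_le_norm c
    have hci := Complex.abs_im_le_norm c
    have hci' : |-c.im| ≤ ‖c‖ := by rwa [abs_neg]
    rw [meanOf, e1, e2, modulusReal_add hm (hb _ hcr _ (hre hφ)) (hb _ hci' _ (him hφ)),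
      modulusReal_add hm (hb _ hcr _ (him hφ)) (hb _ hci _ (hre hφ)),
      modulusReal_smul hm (hre hφ), modulusReal_smul hm (hre hφ), modulusReal_smul hm (him hφ),
      modulusReal_smul hm (him hφ), meanOf, ← mul_div_assoc]
    congr 1
    conv_rhs => rw [← Complex.re_add_im c]
    push_cast
    linear_combination (-c.im * modulusReal m (fun x => (φ x).im) : ℂ) * Complex.I_sq
  · intro φ C hC hφ
    have h1 := abs_modulusReal_le hm hC (hre hφ)
    have h2 := abs_modulusReal_le hm hC (him hφ)
    have h0 := modulus_nonneg m 1
    rw [meanOf, norm_div, Complex.norm_real, Real.norm_of_nonneg h0]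
    refine div_le_of_le_mul₀ h0 (by positivity) ?_
    refine (norm_add_le _ _).trans ?_
    rw [norm_mul, Complex.norm_I, one_mul, Complex.norm_real, Complex.norm_real,
      Real.norm_eq_abs, Real.norm_eq_abs]
    linarith

lemma meanOf_one (hm : IsBoundedFunctional m B) (h : m 1 ≠ 0) : meanOf m 1 = 1 := by
  have hpos : 0 < modulus m 1 :=
    (norm_pos_iff.mpr h).trans_le (norm_le_modulus hm (C := 1) (by simp) (by simp))
  have h1 : modulusReal m (fun x => ((1 : X → ℂ) x).re) = modulus m 1 := by
    have e1 : (fun x : X => max (((1 : X → ℂ) x).re) 0) = 1 := by funext x; simp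
    have e2 : (fun x : X => max (-((1 : X → ℂ) x).re) 0) = 0 := by funext x; simp
    rw [modulusReal, e1, e2, modulus_zero hm, sub_zero]
  have h2 : modulusReal m (fun x => ((1 : X → ℂ) x).im) = 0 := by
    simp [modulusReal]
  rw [meanOf, h1, h2]
  simp [hpos.ne']

end Modulus

section InvariantMeans

variable {S : Type*} [InverseSemigroup S]

open Classical in
/-- Left translation by `t` of a function on `S` regarded as the underlying groupoid. -/
def act {Y : Type*} [Zero Y] (t : S) (φ : S → Y) : S → Y :=
  fun a => if src t = rng a then φ (t * a) else 0

lemma norm_act_le {t : S} {φ : S → ℂ} {f : S → ℝ} (h : ∀ a, ‖φ a‖ ≤ f a) (a : S) :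
    ‖act t φ a‖ ≤ act t f a := by
  unfold act; split_ifs
  · exact h _
  · simp

lemma act_nonneg {t : S} {f : S → ℝ} (h : ∀ a, 0 ≤ f a) (a : S) : 0 ≤ act t f a := by
  unfold act; split_ifs
  · exact h _
  · rfl

lemma act_le {t : S} {f : S → ℝ} {C : ℝ} (hC : 0 ≤ C) (h : ∀ a, f a ≤ C) (a : S) :
    act t f a ≤ C := by
  unfold act; split_ifs
  · exact h _
  · exact hC

lemma act_star_act_le {t : S} {f : S → ℝ} (h : ∀ a, 0 ≤ f a) (a : S) :
    act (star t) (act t f) a ≤ f a := by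
  unfold act; split_ifs with h1 h2
  · rw [src_star] at h1
    rw [← mul_assoc, ← rng, h1, rng_mul]
  · exact h a
  · exact h a

/-- Left invariance over the groupoid `S` of a family of functionals. -/
def IsInvariantFamily (m : S → (S → ℂ) → ℂ) : Prop :=
  ∀ (t : S) (φ : S → ℂ) (C : ℝ), (∀ a, ‖φ a‖ ≤ C) → m (rng t) φ = m (src t) (act t φ)

variable {m : S → (S → ℂ) → ℂ}

lemma modulus_invariant (hb : ∀ x, ∃ B, IsBoundedFunctional (m x) B) (hi : IsInvariantFamily m)
    (t : S) {f : S → ℝ} {C : ℝ} (h0 : ∀ a, 0 ≤ f a) (hf : ∀ a, f a ≤ C) :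
    modulus (m (rng t)) f = modulus (m (src t)) (act t f) := by
  have key : ∀ (t : S) (f : S → ℝ), (∀ a, 0 ≤ f a) → (∀ a, f a ≤ C) →
      modulus (m (rng t)) f ≤ modulus (m (src t)) (act t f) := by
    intro t f h0 hf
    obtain ⟨B, hB⟩ := hb (src t)
    have hC : 0 ≤ C := (h0 t).trans (hf t)
    refine modulus_le h0 fun g hg => ?_
    rw [hi t g C fun a => (hg a).trans (hf a)]
    exact norm_le_modulus hB (act_le hC hf) (norm_act_le hg)
  refine le_antisymm (key t f h0 hf) ?_
  have hC : 0 ≤ C := (h0 t).trans (hf t)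
  have h := key (star t) (act t f) (act_nonneg h0) (act_le hC hf)
  rw [rng_star, src_star] at h
  obtain ⟨B, hB⟩ := hb (rng t)
  exact h.trans (modulus_mono hB (act_nonneg (act_nonneg h0)) (act_star_act_le h0) hf)

lemma modulusReal_invariant (hb : ∀ x, ∃ B, IsBoundedFunctional (m x) B)
    (hi : IsInvariantFamily m) (t : S) {f : S → ℝ} {C : ℝ} (hf : ∀ a, |f a| ≤ C) :
    modulusReal (m (rng t)) f = modulusReal (m (src t)) (act t f) := by
  obtain ⟨a1, a2, a3, a4⟩ := max_bounds hf
  rw [modulusReal, modulusReal, modulus_invariant hb hi t a1 a2,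
    modulus_invariant hb hi t a3 a4]
  congr 2 <;>
  · funext a
    unfold act
    split_ifs <;> simp

lemma modulus_one_invariant (hb : ∀ x, ∃ B, IsBoundedFunctional (m x) B)
    (hi : IsInvariantFamily m) (t : S) : modulus (m (rng t)) 1 = modulus (m (src t)) 1 := by
  have key : ∀ t : S, modulus (m (rng t)) 1 ≤ modulus (m (src t)) 1 := by
    intro t
    obtain ⟨B, hB⟩ := hb (src t)
    rw [modulus_invariant hb hi t (f := 1) (C := 1) (by simp) (by simp)]
    exact modulus_mono hB (act_nonneg (by simp)) (f' := 1) (C := 1)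
      (fun a => act_le (C := 1) zero_le_one (by simp) a) (by simp)
  refine le_antisymm (key t) ?_
  have h := key (star t)
  rwa [rng_star, src_star] at h

/-- Nonvanishing invariant functionals can be replaced by uniformly bounded invariant means. -/
lemma exists_invariant_means (hb : ∀ x, ∃ B, IsBoundedFunctional (m x) B)
    (hi : IsInvariantFamily m) (h1 : ∀ x, x * x = x → m x 1 ≠ 0) :
    ∃ M : S → (S → ℂ) → ℂ, (∀ x, IsBoundedFunctional (M x) 2) ∧ IsInvariantFamily M ∧
      ∀ x, x * x = x → M x 1 = 1 := by
  refine ⟨fun x => meanOf (m x), fun x => ?_, fun t φ C hφ => ?_, fun x hx => ?_⟩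
  · obtain ⟨B, hB⟩ := hb x
    exact isBoundedFunctional_meanOf hB
  · have e1 : (fun a => (act t φ a).re) = act t fun a => (φ a).re := by
      funext a; unfold act; split_ifs <;> simp
    have e2 : (fun a => (act t φ a).im) = act t fun a => (φ a).im := by
      funext a; unfold act; split_ifs <;> simp
    simp only [meanOf, e1, e2]
    rw [modulusReal_invariant hb hi t fun a => (Complex.abs_re_le_norm _).trans (hφ a),
      modulusReal_invariant hb hi t fun a => (Complex.abs_im_le_norm _).trans (hφ a),
      modulus_one_invariant hb hi t]
  · obtain ⟨B, hB⟩ := hb x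
    exact meanOf_one hB (h1 x hx)

end InvariantMeans

section GroupoidBasis

variable {S : Type*} [InverseSemigroup S]
  {R : Type*} [NonUnitalNormedRing R] [NormedSpace ℂ R]
  [IsScalarTower ℂ R R] [SMulCommClass ℂ R R]

/-- `u` is an `ℓ¹`-basis of `R` that multiplies as the groupoid underlying `S`. -/
structure IsGroupoidBasis (u : S → R) (K : ℝ) : Prop where
  nonneg : 0 ≤ K
  norm_le : ∀ s, ‖u s‖ ≤ K
  ext : ∀ F G : Dual' R, (∀ s, F (u s) = G (u s)) → F = G
  dual : ∀ φ : S → ℂ, ∃ F : Dual' R, ∀ C : ℝ, 0 ≤ C → (∀ s, ‖φ s‖ ≤ C) →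
    ‖F‖ ≤ K * C ∧ ∀ s, F (u s) = φ s
  bil : ∀ φ : S → S → ℂ, ∃ T : BilForm R, ∀ C : ℝ, 0 ≤ C → (∀ s t, ‖φ s t‖ ≤ C) →
    ‖T‖ ≤ K * C ∧ ∀ s t, T (u s) (u t) = φ s t
  mul : ∀ s t, src s = rng t → u s * u t = u (s * t)
  mul_eq_zero : ∀ s t, src s ≠ rng t → u s * u t = 0

variable {u : S → R} {K : ℝ}

lemma IsGroupoidBasis.bil_ext (hu : IsGroupoidBasis u K) {T T' : BilForm R}
    (h : ∀ s t, T (u s) (u t) = T' (u s) (u t)) : T = T' := by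
  have h1 : ∀ s, T (u s) = T' (u s) := fun s => hu.ext _ _ (h s)
  have h2 : ∀ y, T.flip y = T'.flip y := fun y => hu.ext _ _ fun s => by
    simp [h1 s]
  ext x y
  exact DFunLike.congr_fun (h2 y) x

open Classical in
/-- The bounded functions on `S × S` whose image under a bimodule morphism gives invariant
functionals. -/
def leftKernel (x : S) (φ : S → ℂ) (a b : S) : ℂ :=
  if src a = rng b ∧ src b = x then φ a else 0

lemma norm_leftKernel_le {x : S} {φ : S → ℂ} {C : ℝ} (hφ : ∀ s, ‖φ s‖ ≤ C) (a b : S) :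
    ‖leftKernel x φ a b‖ ≤ C := by
  unfold leftKernel; split_ifs
  · exact hφ a
  · simpa using (norm_nonneg _).trans (hφ a)

/-- A bimodule morphism induces invariant functionals on the groupoid. -/
lemma exists_invariant_functionals (hu : IsGroupoidBasis u K) :
    ∃ m : (BilForm R →L[ℂ] Dual' R) → S → (S → ℂ) → ℂ,
      (∀ ρ x, ∃ B, IsBoundedFunctional (m ρ x) B) ∧
      (∀ ρ, IsBimodMorphism ρ → IsInvariantFamily (m ρ)) ∧
      ∀ x, x * x = x → ∃ f : Dual' R, f (u x) = 1 ∧ ∀ ρ, m ρ x 1 = ρ (piStar f) (u x) := by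
  classical
  choose T hT using fun (x : S) (φ : S → ℂ) => hu.bil (leftKernel x φ)
  have hv : ∀ x φ C, (∀ s : S, ‖φ s‖ ≤ C) → ∀ s t, T x φ (u s) (u t) = leftKernel x φ s t :=
    fun x φ C hφ => (hT x φ C ((norm_nonneg _).trans (hφ x)) (norm_leftKernel_le hφ)).2
  refine ⟨fun ρ x φ => ρ (T x φ) (u x), fun ρ x => ⟨‖ρ‖ * K * K, ?_, ?_, ?_, ?_⟩, ?_, ?_⟩
  · have := hu.nonneg; positivity
  · intro φ ψ C hφ hψ
    have : T x (φ + ψ) = T x φ + T x ψ := by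
      refine hu.bil_ext fun s t => ?_
      rw [hv x (φ + ψ) (C + C) fun s => (norm_add_le _ _).trans (add_le_add (hφ s) (hψ s)),
        add_apply, add_apply, hv x φ C hφ, hv x ψ C hψ]
      unfold leftKernel; split_ifs <;> simp
    simp [this]
  · intro c φ C hφ
    have : T x (c • φ) = c • T x φ := by
      refine hu.bil_ext fun s t => ?_
      rw [hv x (c • φ) (‖c‖ * C) fun s => by
          rw [Pi.smul_apply, norm_smul]
          exact mul_le_mul_of_nonneg_left (hφ s) (norm_nonneg c),
        smul_apply, smul_apply, hv x φ C hφ]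
      unfold leftKernel; split_ifs <;> simp
    simp [this]
  · intro φ C hC hφ
    have h1 := (hT x φ C hC (norm_leftKernel_le hφ)).1
    have hK := hu.nonneg
    calc ‖ρ (T x φ) (u x)‖ ≤ ‖ρ (T x φ)‖ * ‖u x‖ := le_opNorm _ _
      _ ≤ ‖ρ‖ * ‖T x φ‖ * ‖u x‖ := by gcongr; exact le_opNorm _ _
      _ ≤ ‖ρ‖ * (K * C) * K := by gcongr; exact hu.norm_le x
      _ = ‖ρ‖ * K * K * C := by ring
  · intro ρ hρ t φ C hφ
    have hφ' : ∀ a, ‖act t φ a‖ ≤ C := fun a => by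
      unfold act; split_ifs
      · exact hφ _
      · simpa using (norm_nonneg _).trans (hφ a)
    have e1 : bilLeft (u t) (T (src t) φ) = T (rng t) φ := by
      refine hu.bil_ext fun a b => ?_
      rw [bilLeft_apply, hv _ φ C hφ]
      by_cases h : src b = rng t
      · rw [hu.mul _ _ h, hv _ φ C hφ, leftKernel, leftKernel, src_mul h, rng_mul_eq h]
        simp [h]
      · rw [hu.mul_eq_zero _ _ h, leftKernel]
        simp [h]
    have e2 : bilRight (u t) (T (src t) φ) = T (src t) (act t φ) := by
      refine hu.bil_ext fun a b => ?_
      rw [bilRight_apply, hv _ _ C hφ']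
      by_cases h : src t = rng a
      · rw [hu.mul _ _ h, hv _ φ C hφ, leftKernel, leftKernel, src_mul h]
        simp [h, act]
      · rw [hu.mul_eq_zero _ _ h, leftKernel]
        simp [h, act]
    have m1 : u (rng t) * u t = u t := by
      rw [hu.mul _ _ (src_of_idem (rng_idem t)), rng_mul]
    have m2 : u t * u (src t) = u t := by
      rw [hu.mul _ _ (rng_of_idem (src_idem t)).symm, mul_src]
    show ρ (T (rng t) φ) (u (rng t)) = ρ (T (src t) (act t φ)) (u (src t))
    rw [← e1, ← e2, (hρ _ _).1, (hρ _ _).2, dualLeft_apply, dualRight_apply, m1, m2]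
  · intro x hx
    classical
    obtain ⟨f, hf⟩ := hu.dual fun s => if src s = x then 1 else 0
    obtain ⟨-, hf⟩ := hf 1 zero_le_one fun s => by split_ifs <;> simp
    refine ⟨f, by rw [hf, if_pos (src_of_idem hx)], fun ρ => ?_⟩
    have : T x 1 = piStar f := by
      refine hu.bil_ext fun a b => ?_
      rw [hv x 1 1 (by simp), piStar_apply, leftKernel]
      by_cases h : src a = rng b
      · rw [hu.mul _ _ h, hf, src_mul h]
        simp [h]
      · rw [hu.mul_eq_zero _ _ h]
        simp [h]
    show ρ (T x 1) (u x) = _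
    rw [this]

lemma isBimodMorphism_zero : IsBimodMorphism (0 : BilForm R →L[ℂ] Dual' R) := by
  intro a T
  simp

/-- The objects in the connected component of `x` in the groupoid underlying `S`. -/
def component (x : S) : Set S := {y | ∃ t, src t = x ∧ rng t = y}

lemma component_src_eq (t : S) : component (src t) = component (rng t) := by
  have key : ∀ t : S, component (rng t) ⊆ component (src t) := by
    rintro t _ ⟨r, hr, rfl⟩
    exact ⟨r * t, src_mul hr, rng_mul_eq hr⟩
  refine subset_antisymm ?_ (key t)
  have h := key (star t)
  rwa [rng_star, src_star] at h

lemma exists_means_of_approximatelyBiflat (hu : IsGroupoidBasis u K)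
    (h : ApproximatelyBiflat R) :
    ∃ M : S → (S → ℂ) → ℂ, (∀ x, IsBoundedFunctional (M x) 2) ∧ IsInvariantFamily M ∧
      ∀ x, x * x = x → M x 1 = 1 := by
  obtain ⟨l, hl, hlb, hlt⟩ := h
  obtain ⟨m, hm1, hm2, hm3⟩ := exists_invariant_functionals hu
  have hne : ∀ x, x * x = x → ∃ ρ, IsBimodMorphism ρ ∧ m ρ x 1 ≠ 0 := by
    intro x hx
    obtain ⟨f, hf, hfm⟩ := hm3 x hx
    have ht := hlt f (u x)
    rw [hf] at ht
    obtain ⟨ρ, hρ, hρ'⟩ := (hlb.and (ht.eventually_ne one_ne_zero)).exists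
    exact ⟨ρ, hρ, by rwa [hfm]⟩
  have hc : ∀ O : Set S, ∃ ρ : BilForm R →L[ℂ] Dual' R, IsBimodMorphism ρ ∧
      ∀ x, x * x = x → component x = O → m ρ x 1 ≠ 0 := by
    intro O
    by_cases hO : ∃ x : S, x * x = x ∧ component x = O
    · obtain ⟨x, hx, rfl⟩ := hO
      obtain ⟨ρ, hρ, hρx⟩ := hne x hx
      refine ⟨ρ, hρ, fun y hy hyx => ?_⟩
      have hy' : y ∈ component x := by
        rw [← hyx]; exact ⟨y, src_of_idem hy, rng_of_idem hy⟩
      obtain ⟨t, ht, rfl⟩ := hy'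
      have h1 := hm2 ρ hρ t 1 1 (by simp)
      have h2 := hm2 ρ hρ x 1 1 (by simp)
      have h3 : act t (1 : S → ℂ) = act x 1 := by
        funext a
        simp only [act, Pi.one_apply]
        rw [ht, src_of_idem hx]
      rw [src_of_idem hx, rng_of_idem hx] at h2
      rwa [h1, ht, h3, ← h2]
    · exact ⟨0, isBimodMorphism_zero, fun x hx hxO => absurd ⟨x, hx, hxO⟩ hO⟩
  choose ρ hρ hρ' using hc
  refine exists_invariant_means (m := fun x => m (ρ (component x)) x) (fun x => hm1 _ _) ?_
    fun x hx => hρ' _ x hx rfl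
  intro t φ C hφ
  show m (ρ (component (rng t))) _ _ = m (ρ (component (src t))) _ _
  rw [component_src_eq]
  exact hm2 _ (hρ _) t φ C hφ

/-- The kernel `h ↦ T(u_s u_h, u_{h*})` that is averaged to get the biflatness morphism. -/
def diagKernel (u : S → R) (s : S) (T : BilForm R) (h : S) : ℂ := T (u s * u h) (u (star h))

lemma IsGroupoidBasis.norm_diagKernel_le (hu : IsGroupoidBasis u K) (s : S) (T : BilForm R)
    (h : S) : ‖diagKernel u s T h‖ ≤ ‖T‖ * (K * K) * K := by
  have hK := hu.nonneg
  calc ‖T (u s * u h) (u (star h))‖ ≤ ‖T (u s * u h)‖ * ‖u (star h)‖ := le_opNorm _ _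
    _ ≤ ‖T‖ * ‖u s * u h‖ * ‖u (star h)‖ := by gcongr; exact le_opNorm _ _
    _ ≤ ‖T‖ * (‖u s‖ * ‖u h‖) * ‖u (star h)‖ := by gcongr; exact norm_mul_le _ _
    _ ≤ ‖T‖ * (K * K) * K := by gcongr <;> exact hu.norm_le _

lemma biflat_of_means (hu : IsGroupoidBasis u K) {M : S → (S → ℂ) → ℂ}
    (hM : ∀ x, IsBoundedFunctional (M x) 2) (hi : IsInvariantFamily M)
    (h1 : ∀ x, x * x = x → M x 1 = 1) : Biflat R := by
  have hK := hu.nonneg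
  have hk := hu.norm_diagKernel_le
  have hbd : ∀ (T : BilForm R) (s : S),
      ‖M (src s) (diagKernel u s T)‖ ≤ 2 * (‖T‖ * (K * K) * K) := fun T s =>
    (hM _).bound _ _ (by positivity) (hk s T)
  choose F hF using fun T : BilForm R => hu.dual fun s => M (src s) (diagKernel u s T)
  have hFv : ∀ T s, F T (u s) = M (src s) (diagKernel u s T) := fun T =>
    (hF T _ (by positivity) (hbd T)).2
  have hFn : ∀ T, ‖F T‖ ≤ K * (2 * (‖T‖ * (K * K) * K)) := fun T =>
    (hF T _ (by positivity) (hbd T)).1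
  let ρ : BilForm R →L[ℂ] Dual' R := LinearMap.mkContinuous
    { toFun := F
      map_add' := fun T T' => hu.ext _ _ fun s => by
        rw [add_apply, hFv, hFv, hFv, ← (hM _).add _ _ (max _ _)
          (fun a => (hk s T a).trans (le_max_left _ _))
          (fun a => (hk s T' a).trans (le_max_right _ _))]
        rfl
      map_smul' := fun c T => hu.ext _ _ fun s => by
        rw [RingHom.id_apply, smul_apply, hFv, hFv, smul_eq_mul, ← (hM _).smul _ _ _ (hk s T)]
        rfl }
    (2 * K * K * K * K) fun T => (hFn T).trans (le_of_eq (by ring))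
  have hρ : ∀ T s, ρ T (u s) = M (src s) (diagKernel u s T) := hFv
  refine ⟨ρ, fun a T => ⟨?_, ?_⟩, fun f => ?_⟩
  · refine hu.ext _ _ fun s => ?_
    let L : Dual' R := (ContinuousLinearMap.apply ℂ ℂ (u s)).comp (ρ.comp
      (((compL ℂ R (Dual' R) (Dual' R)).flip T).comp
        ((compL ℂ R R ℂ).flip.comp (ContinuousLinearMap.mul ℂ R).flip)))
    suffices L = (ρ T).comp (ContinuousLinearMap.mul ℂ R (u s)) from DFunLike.congr_fun this a
    refine hu.ext _ _ fun t => ?_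
    show ρ (bilLeft (u t) T) (u s) = ρ T (u s * u t)
    rw [hρ]
    by_cases h : src s = rng t
    · rw [hu.mul _ _ h, hρ, src_mul h, h, hi t _ _ (hk _ _)]
      congr 1
      funext a
      by_cases ha : src t = rng a
      · have e1 : src (star (t * a)) = rng t := by rw [src_star, rng_mul_eq ha]
        have e2 : star (t * a) * t = star a := by
          rw [InverseSemigroup.star_mul, mul_assoc, ← src, ha, star_mul_rng]
        rw [act, if_pos ha, diagKernel, bilLeft_apply, diagKernel, hu.mul _ _ e1, e2,
          ← hu.mul _ _ ha, ← mul_assoc, hu.mul _ _ h]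
      · rw [act, if_neg ha, diagKernel, hu.mul_eq_zero _ _ (by rwa [src_mul h])]
        simp
    · rw [hu.mul_eq_zero _ _ h, map_zero]
      have : diagKernel u s (bilLeft (u t) T) = 0 := by
        funext a
        rw [diagKernel, bilLeft_apply]
        by_cases ha : src s = rng a
        · rw [hu.mul_eq_zero (star a) t (by rw [src_star, ← ha]; exact h)]
          simp
        · rw [hu.mul_eq_zero _ _ ha]
          simp
      rw [this, (hM _).map_zero]
  · refine hu.ext _ _ fun s => ?_
    let L : Dual' R := (ContinuousLinearMap.apply ℂ ℂ (u s)).comp (ρ.comp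
      ((compL ℂ R R (Dual' R) T).comp (ContinuousLinearMap.mul ℂ R)))
    suffices L = (ρ T).comp ((ContinuousLinearMap.mul ℂ R).flip (u s)) from
      DFunLike.congr_fun this a
    refine hu.ext _ _ fun t => ?_
    show ρ (bilRight (u t) T) (u s) = ρ T (u t * u s)
    rw [hρ]
    by_cases h : src t = rng s
    · rw [hu.mul _ _ h, hρ, src_mul h]
      congr 1
      funext a
      rw [diagKernel, bilRight_apply, diagKernel, ← mul_assoc, hu.mul _ _ h]
    · rw [hu.mul_eq_zero _ _ h, map_zero]
      have : diagKernel u s (bilRight (u t) T) = 0 := by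
        funext a
        rw [diagKernel, bilRight_apply, ← mul_assoc, hu.mul_eq_zero _ _ h]
        simp
      rw [this, (hM _).map_zero]
  · refine hu.ext _ _ fun s => ?_
    have e : diagKernel u s (piStar f) = f (u s) • act (src s) 1 := by
      funext a
      have e1 : src a = rng (star a) := (rng_star a).symm
      rw [diagKernel, piStar_apply, mul_assoc, hu.mul _ _ e1, ← rng, Pi.smul_apply, act,
        src_of_idem (src_idem s)]
      by_cases h : src s = rng a
      · rw [hu.mul _ _ (by rw [rng_of_idem (rng_idem a), h]), ← h, mul_src]
        simp
      · rw [hu.mul_eq_zero _ _ (by rwa [rng_of_idem (rng_idem a)])]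
        simp [h]
    have hs := hi (src s) 1 1 (by simp)
    rw [rng_of_idem (src_idem s), src_of_idem (src_idem s), h1 _ (src_idem s)] at hs
    rw [hρ, e, (hM _).smul _ _ 1 (fun a => by unfold act; split_ifs <;> simp), ← hs, mul_one]

end GroupoidBasis

section PointMass

variable {S : Type*} {R : Type*} [NonUnitalNormedRing R] [NormedSpace ℂ R]

open Classical in
/-- The element of `R ≅ ℓ¹(S)` corresponding to the point mass at `s`. -/
def point (e : R ≃ₗᵢ[ℂ] lp (fun _ : S => ℂ) 1) (s : S) : R :=
  e.symm (lp.single 1 s (1 : ℂ))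

variable (e : R ≃ₗᵢ[ℂ] lp (fun _ : S => ℂ) 1)

lemma norm_point (s : S) : ‖point e s‖ = 1 := by
  classical
  rw [point, LinearIsometryEquiv.norm_map, lp.norm_single one_pos, norm_one]

lemma apply_point (s : S) : e (point e s) s = 1 := by
  simp [point]

lemma apply_point_of_ne {s t : S} (h : t ≠ s) : e (point e s) t = 0 := by
  simp [point, h]

lemma hasSum_point (f : R) : HasSum (fun s => e f s • point e s) f := by
  classical
  have h := (lp.hasSum_single ENNReal.one_ne_top (e f)).mapL
    (e.symm.toContinuousLinearEquiv : lp (fun _ : S => ℂ) 1 →L[ℂ] R)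
  have h2 : (fun s => e f s • point e s) = fun s =>
      (e.symm.toContinuousLinearEquiv : lp (fun _ : S => ℂ) 1 →L[ℂ] R) (lp.single 1 s (e f s)) := by
    funext s
    have := lp.single_smul (E := fun _ : S => ℂ) 1 s (e f s) (1 : ℂ)
    rw [smul_eq_mul, mul_one] at this
    rw [this, map_smul]
    rfl
  rw [h2]
  simpa using h

variable {Y : Type*} [NormedAddCommGroup Y] [NormedSpace ℂ Y]

lemma clm_ext_point {L L' : R →L[ℂ] Y} (h : ∀ s, L (point e s) = L' (point e s)) : L = L' := by
  ext f
  have h1 := (hasSum_point e f).mapL L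
  have h2 := (hasSum_point e f).mapL L'
  simp only [map_smul, h] at h1 h2
  exact h1.unique h2

lemma hasSum_norm (f : R) : HasSum (fun s => ‖e f s‖) ‖f‖ := by
  have h := lp.hasSum_norm (p := 1) (by simp) (e f)
  simpa using h

lemma exists_lift [CompleteSpace Y] (y : S → Y) :
    ∃ L : R →L[ℂ] Y, ∀ C : ℝ, 0 ≤ C → (∀ s, ‖y s‖ ≤ C) →
      ‖L‖ ≤ C ∧ ∀ s, L (point e s) = y s := by
  by_cases hy : ∃ C : ℝ, ∀ s, ‖y s‖ ≤ C
  · obtain ⟨C, hC⟩ := hy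
    have hle : ∀ {D : ℝ}, (∀ s, ‖y s‖ ≤ D) → ∀ f s, ‖e f s • y s‖ ≤ D * ‖e f s‖ := by
      intro D hD f s
      rw [norm_smul, mul_comm]
      exact mul_le_mul_of_nonneg_right (hD s) (norm_nonneg _)
    have hs : ∀ f, Summable fun s => e f s • y s := fun f =>
      Summable.of_norm_bounded ((hasSum_norm e f).summable.mul_left C) (hle hC f)
    have hb : ∀ {D : ℝ}, (∀ s, ‖y s‖ ≤ D) → ∀ f, ‖∑' s, e f s • y s‖ ≤ D * ‖f‖ :=
      fun hD f => tsum_of_norm_bounded ((hasSum_norm e f).mul_left _) (hle hD f)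
    let L₀ : R →ₗ[ℂ] Y :=
      { toFun := fun f => ∑' s, e f s • y s
        map_add' := fun f g => by
          rw [← (hs f).tsum_add (hs g)]
          simp [add_smul]
        map_smul' := fun c f => by
          rw [RingHom.id_apply, ← (hs f).tsum_const_smul c]
          simp [mul_smul] }
    refine ⟨L₀.mkContinuous C (hb hC), fun D hD hyD => ⟨?_, fun s => ?_⟩⟩
    · exact ContinuousLinearMap.opNorm_le_bound _ hD (hb hyD)
    · change ∑' t, e (point e s) t • y t = y s
      rw [tsum_eq_single s fun t ht => by rw [apply_point_of_ne e ht, zero_smul],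
        apply_point, one_smul]
  · exact ⟨0, fun C _ hC => absurd ⟨C, hC⟩ hy⟩

lemma exists_lift₂ [CompleteSpace Y] (y : S → S → Y) :
    ∃ T : R →L[ℂ] R →L[ℂ] Y, ∀ C : ℝ, 0 ≤ C → (∀ s t, ‖y s t‖ ≤ C) →
      ‖T‖ ≤ C ∧ ∀ s t, T (point e s) (point e t) = y s t := by
  choose L hL using fun s => exists_lift e (y s)
  obtain ⟨T, hT⟩ := exists_lift e L
  refine ⟨T, fun C hC hy => ?_⟩
  obtain ⟨h1, h2⟩ := hT C hC fun s => (hL s C hC (hy s)).1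
  exact ⟨h1, fun s t => by rw [h2, (hL s C hC (hy s)).2]⟩

lemma point_mul_point [Mul S] (hmul : ∀ (f g : R) (t : S),
    e (f * g) t = ∑' p : {p : S × S // p.1 * p.2 = t}, e f p.1.1 * e g p.1.2) (s t : S) :
    point e s * point e t = point e (s * t) := by
  apply e.injective
  ext c
  rw [hmul]
  by_cases hc : s * t = c
  · subst hc
    rw [tsum_eq_single ⟨(s, t), rfl⟩, apply_point, apply_point, apply_point, one_mul]
    rintro ⟨⟨a, b⟩, hab⟩ hne
    by_cases ha : a = s
    · have hb : b ≠ t := by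
        rintro rfl
        exact hne (by simp [ha])
      rw [apply_point_of_ne e hb, mul_zero]
    · rw [apply_point_of_ne e ha, zero_mul]
  · rw [apply_point_of_ne e (Ne.symm hc)]
    refine (tsum_congr ?_).trans tsum_zero
    rintro ⟨⟨a, b⟩, hab⟩
    by_cases ha : a = s
    · have hb : b ≠ t := by
        rintro rfl
        exact hc (by rw [← hab, ha])
      rw [apply_point_of_ne e hb, mul_zero]
    · rw [apply_point_of_ne e ha, zero_mul]

end PointMass

section MobiusBasis

variable {S : Type*} [InverseSemigroup S] {R : Type*} [NonUnitalNormedRing R] [NormedSpace ℂ R]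
  [CompleteSpace R] (e : R ≃ₗᵢ[ℂ] lp (fun _ : S => ℂ) 1) {n : ℕ} {b : S → Finset S}

lemma card_lt_of_natLE (hb : ∀ a s, a ∈ b s ↔ NatLE a s) {a s : S} (h : NatLE a s)
    (hne : a ≠ s) : (b a).card < (b s).card := by
  refine Finset.card_lt_card ⟨fun c hc => ?_, fun hs => hne ?_⟩
  · rw [hb] at hc ⊢
    exact hc.trans h
  · exact h.antisymm ((hb _ _).1 (hs ((hb _ _).2 (NatLE.refl s))))

/-- The zeta operator `δ_s ↦ ∑ a ≤ s, δ_a` of `ℓ¹(S)` is invertible. -/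
lemma exists_zeta (hb : ∀ a s, a ∈ b s ↔ NatLE a s) (hn : ∀ s, (b s).card ≤ n) :
    ∃ P Q : R →L[ℂ] R, (∀ x, P (Q x) = x) ∧ (∀ x, Q (P x) = x) ∧
      ∀ s, P (point e s) = ∑ a ∈ b s, point e a := by
  classical
  obtain ⟨N, hN⟩ := exists_lift e fun s => ∑ a ∈ (b s).erase s, point e a
  have hN' : ∀ s, N (point e s) = ∑ a ∈ (b s).erase s, point e a := by
    refine (hN n n.cast_nonneg fun s => ?_).2
    refine (norm_sum_le _ _).trans ?_
    simp only [norm_point, Finset.sum_const, nsmul_eq_mul, mul_one]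
    exact_mod_cast (Finset.card_erase_le).trans (hn s)
  have hpow : ∀ k s, (b s).card ≤ k → (N ^ k) (point e s) = 0 := by
    intro k
    induction k with
    | zero =>
      intro s hs
      have : s ∈ b s := (hb s s).2 (NatLE.refl s)
      rw [Finset.card_eq_zero.1 (Nat.le_zero.1 hs)] at this
      simp at this
    | succ k ih =>
      intro s hs
      rw [pow_succ, mul_apply_eq_comp, hN', map_sum]
      refine Finset.sum_eq_zero fun a ha => ih a ?_
      rw [Finset.mem_erase, hb] at ha
      have := card_lt_of_natLE hb ha.2 ha.1
      omega
  have hnil : IsNilpotent N := ⟨n, clm_ext_point e fun s => by rw [hpow n s (hn s)]; rfl⟩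
  obtain ⟨P, hP⟩ := hnil.isUnit_one_add
  refine ⟨P, ↑P⁻¹, fun x => ?_, fun x => ?_, fun s => ?_⟩
  · rw [← mul_apply_eq_comp, P.mul_inv]; rfl
  · rw [← mul_apply_eq_comp, P.inv_mul]; rfl
  · rw [hP, add_apply, hN']
    exact Finset.add_sum_erase _ (point e) ((hb s s).2 (NatLE.refl s))

lemma sum_factor {M : Type*} [AddCommMonoid M] (hb : ∀ a s, a ∈ b s ↔ NatLE a s) (f : S → M)
    [DecidableEq S] (s t : S) :
    ∑ a ∈ b s, ∑ c ∈ b t, (if src a = rng c then f (a * c) else 0) = ∑ d ∈ b (s * t), f d := by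
  rw [← Finset.sum_product', ← Finset.sum_filter]
  refine Finset.sum_bij' (fun p _ => p.1 * p.2) (fun d _ => (rng d * s, t * src d)) ?_ ?_ ?_ ?_ ?_
  · rintro ⟨a, c⟩ h
    simp only [Finset.mem_filter, Finset.mem_product, hb] at h ⊢
    exact (factor_unique h.1.1 h.1.2 h.2).1
  · intro d h
    rw [hb] at h
    simp only [Finset.mem_filter, Finset.mem_product, hb]
    exact ⟨⟨(exists_factor h).1, (exists_factor h).2.1⟩, (exists_factor h).2.2.1⟩
  · rintro ⟨a, c⟩ h
    simp only [Finset.mem_filter, Finset.mem_product, hb] at h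
    obtain ⟨-, h1, h2⟩ := factor_unique h.1.1 h.1.2 h.2
    exact Prod.ext h1 h2
  · intro d h
    rw [hb] at h
    exact (exists_factor h).2.2.2
  · intro p _
    rfl

variable [IsScalarTower ℂ R R] [SMulCommClass ℂ R R]

lemma exists_isGroupoidBasis (hb : ∀ a s, a ∈ b s ↔ NatLE a s) (hn : ∀ s, (b s).card ≤ n)
    (hmul : ∀ s t, point e s * point e t = point e (s * t)) :
    ∃ (u : S → R) (K : ℝ), IsGroupoidBasis u K := by
  classical
  obtain ⟨P, Q, hPQ, hQP, hP⟩ := exists_zeta e hb hn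
  have hQ : ∀ s, ‖Q (point e s)‖ ≤ ‖Q‖ := fun s => by
    simpa [norm_point] using Q.le_opNorm (point e s)
  have hsum : ∀ s, point e s = ∑ a ∈ b s, Q (point e a) := fun s => by
    rw [← map_sum, ← hP, hQP]
  obtain ⟨T, hT⟩ := exists_lift₂ e fun s t : S =>
    if src s = rng t then Q (point e (s * t)) else 0
  have hT' := (hT ‖Q‖ (norm_nonneg _) fun s t => by
    split_ifs
    · exact hQ _
    · simp).2
  have hTmul : T.bilinearComp P P = ContinuousLinearMap.mul ℂ R := by
    refine clm_ext_point e fun s => clm_ext_point e fun t => ?_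
    rw [bilinearComp_apply, ContinuousLinearMap.mul_apply', hmul, hP, hP, hsum (s * t),
      ← sum_factor hb (fun a => Q (point e a)) s t, map_sum, Finset.sum_comm]
    refine Finset.sum_congr rfl fun c _ => ?_
    rw [map_sum, sum_apply]
    exact Finset.sum_congr rfl fun a _ => hT' a c
  have hprod : ∀ s t, Q (point e s) * Q (point e t) =
      if src s = rng t then Q (point e (s * t)) else 0 := fun s t => by
    rw [← hT', ← ContinuousLinearMap.mul_apply' ℂ R, ← hTmul, bilinearComp_apply, hPQ, hPQ]
  have hp := norm_nonneg P
  have hq := norm_nonneg Q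
  refine ⟨fun s => Q (point e s), ‖Q‖ + ‖P‖ + ‖P‖ * ‖P‖, by positivity,
    fun s => (hQ s).trans (by nlinarith), ?_, ?_, ?_, ?_, ?_⟩
  · intro F G h
    have : F.comp Q = G.comp Q := clm_ext_point e h
    ext x
    simpa [hQP] using DFunLike.congr_fun this (P x)
  · intro φ
    obtain ⟨L, hL⟩ := exists_lift e φ
    refine ⟨L.comp P, fun C hC hφ => ⟨?_, fun s => ?_⟩⟩
    · have h1 := L.opNorm_comp_le P
      have h2 := mul_le_mul_of_nonneg_right (hL C hC hφ).1 hp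
      have h3 := mul_nonneg hq hC
      have h4 := mul_nonneg (mul_nonneg hp hp) hC
      linarith
    · rw [comp_apply, hPQ, (hL C hC hφ).2]
  · intro φ
    obtain ⟨L, hL⟩ := exists_lift₂ e φ
    refine ⟨L.bilinearComp P P, fun C hC hφ => ⟨?_, fun s t => ?_⟩⟩
    · refine opNorm_le_bound₂ _ (by positivity) fun x y => ?_
      rw [bilinearComp_apply]
      calc ‖L (P x) (P y)‖ ≤ ‖L‖ * ‖P x‖ * ‖P y‖ := L.le_opNorm₂ _ _
        _ ≤ C * (‖P‖ * ‖x‖) * (‖P‖ * ‖y‖) := by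
          gcongr
          · exact (hL C hC hφ).1
          · exact P.le_opNorm x
          · exact P.le_opNorm y
        _ = ‖P‖ * ‖P‖ * C * ‖x‖ * ‖y‖ := by ring
        _ ≤ (‖Q‖ + ‖P‖ + ‖P‖ * ‖P‖) * C * ‖x‖ * ‖y‖ := by
          gcongr
          linarith
    · rw [bilinearComp_apply, hPQ, hPQ, (hL C hC hφ).2]
  · intro s t h
    rw [hprod, if_pos h]
  · intro s t h
    rw [hprod, if_neg h]

end MobiusBasis

/-- Let `S` be an inverse semigroup such that the set of idempotents `E(S)` is
uniformly locally finite.  Then the semigroup algebra `ℓ¹(S)` (a Banach algebra isometrically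
isomorphic to `ℓ¹(S)` with convolution product) is approximately biflat if and only if it is
biflat. -/
theorem statement9 (S : Type*) [InverseSemigroup S]
    (hULF : IdempotentsUniformlyLocallyFinite S)
    (R : Type*) [NonUnitalNormedRing R] [NormedSpace ℂ R]
    [IsScalarTower ℂ R R] [SMulCommClass ℂ R R] [CompleteSpace R]
    (e : R ≃ₗᵢ[ℂ] lp (fun _ : S => ℂ) 1)
    (hmul : ∀ (f g : R) (t : S),
      e (f * g) t = ∑' p : {p : S × S // p.1 * p.2 = t}, e f p.1.1 * e g p.1.2) :
    ApproximatelyBiflat R ↔ Biflat R := by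
  constructor
  · intro h
    obtain ⟨n, hn⟩ := hULF
    have hfin := finite_natLE hn
    obtain ⟨u, K, hu⟩ := exists_isGroupoidBasis e (n := n) (b := fun s => (hfin s).1.toFinset)
      (fun a s => by simp)
      (fun s => by rw [← Set.ncard_eq_toFinset_card _ (hfin s).1]; exact (hfin s).2)
      (point_mul_point e hmul)
    obtain ⟨M, hM, hi, h1⟩ := exists_means_of_approximatelyBiflat hu h
    exact biflat_of_means hu hM hi h1
  · rintro ⟨ρ, hρ, h⟩
    refine ⟨pure ρ, inferInstance, hρ, fun f a => ?_⟩
    rw [tendsto_pure_left]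
    intro s hs
    rw [h]
    exact mem_of_mem_nhds hs

end ApproxBiflat
end
end
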